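/- arXiv:1708.03054 — 3 statements merged into one kernel-verified Lean document; each statement's English description precedes it below -/
import Mathlib

section
/- (Concentration of the conditional crossing probability, Lemma 3.2.) Suppose c ∈ (0,1/2) and n₀ ≥ 1 are such that c ≤ P_{n,1/2}[f_R = 1] ≤ 1 − c for all n ≥ n₀. Then for every integer k ≥ 16/c⁴ and every n ≥ n₀: P_{kn,1/2}[ P[f_R(η) = 1 | η_k] ∉ [c/2, 1 − c/2] ] ≤ 1/√k, where η_k is distributed as P_{kn,1/2} and η is the 1/k-thinning of η_k. -/
open MeasureTheory ProbabilityTheory Set Filter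
open scoped ENNReal

noncomputable section

abbrev Plane : Type := EuclideanSpace ℝ (Fin 2)
abbrev Pt : Type := Plane × Bool
abbrev Config : Type := Set Pt

/-- The unit square `S = [0,1]²`. -/
def Sq : Set Plane := {x | x 0 ∈ Icc (0:ℝ) 1 ∧ x 1 ∈ Icc (0:ℝ) 1}

/-- The law of the mark of a point: `1` (blue) with probability `p`, `0` (red) otherwise. -/
def markLaw (p : ℝ) : Measure Bool :=
  p.toNNReal • Measure.dirac true + (1 - p).toNNReal • Measure.dirac false

/-- The law of a single point of the process: uniform location in `S`, independent mark. -/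
def ptLaw (p : ℝ) : Measure Pt := (volume.restrict Sq).prod (markLaw p)

/-- Poisson probability mass function with parameter `r`. -/
def pois (r : ℝ) (N : ℕ) : ℝ := Real.exp (-r) * r ^ N / N.factorial

/-- The configuration determined by a finite list of marked points. -/
def cfgOf {N : ℕ} (x : Fin N → Pt) : Config := Set.range x

/-- Expectation of `g` under the Poisson Voronoi law `P_{n,p}`. -/
def PE (n p : ℝ) (g : Config → ℝ) : ℝ :=
  ∑' N : ℕ, pois n N * ∫ x : Fin N → Pt, g (cfgOf x) ∂(Measure.pi fun _ => ptLaw p)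

/-- `y ∈ S` is blue if it belongs to the Voronoi cell of a blue point of `η`. -/
def isBlue (η : Config) (y : Plane) : Prop :=
  ∃ q ∈ η, q.2 = true ∧ ∀ r ∈ η, dist y q.1 ≤ dist y r.1

/-- The rectangle `[a,b] × [c,d]`. -/
def rect (a b c d : ℝ) : Set Plane := {x | x 0 ∈ Icc a b ∧ x 1 ∈ Icc c d}

/-- The horizontal blue crossing event `H_R` for `R = [a,b] × [c,d]`. -/
def Crossing (a b c d : ℝ) (η : Config) : Prop :=
  ∃ K : Set Plane, K ⊆ {y | y ∈ rect a b c d ∧ isBlue η y} ∧ IsConnected K ∧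
    (∃ y ∈ K, y 0 = a) ∧ (∃ y ∈ K, y 0 = b)

open Classical in
/-- The indicator `f_R` of the crossing event. -/
def fR (a b c d : ℝ) (η : Config) : ℝ := if Crossing a b c d η then 1 else 0

/-- Uniform measure on `[0,1]`. -/
def unif01 : Measure ℝ := volume.restrict (Icc (0:ℝ) 1)

/-- Joint expectation of `g (η, η(ε))` where `η ~ P_{n,p}` and `η(ε)` is the `ε`-perturbation
of `η`: each point of `η` is deleted independently with probability `ε` and an independent
process of law `P_{εn,p}` is added. -/
def PE2pert (n p ε : ℝ) (g : Config → Config → ℝ) : ℝ :=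
  ∑' N : ℕ, ∑' M : ℕ, pois n N * pois (ε * n) M *
    ∫ x : Fin N → Pt, ∫ y : Fin M → Pt, ∫ u : Fin N → ℝ,
      g (cfgOf x) ({q | ∃ i, x i = q ∧ ε ≤ u i} ∪ cfgOf y)
      ∂(Measure.pi fun _ => unif01) ∂(Measure.pi fun _ => ptLaw p)
      ∂(Measure.pi fun _ => ptLaw p)

open Classical in
/-- Conditional expectation, given the configuration `η`, of `f` applied to the `1/k`-thinning
of `η` (each point of `η` is kept independently with probability `1/k`). -/
def thinCE (k : ℝ) (f : Config → ℝ) (η : Config) : ℝ :=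
  if h : η.Finite then
    ∑ A ∈ h.toFinset.powerset,
      (1/k) ^ A.card * (1 - 1/k) ^ (h.toFinset.card - A.card) * f ↑A
  else 0

/-- In a compact Hausdorff space, two closed sets that no connected component joins are separated
by a clopen set. -/
theorem exists_isClopen_separating {X : Type*} [TopologicalSpace X] [T2Space X] [CompactSpace X]
    {L R : Set X} (hL : IsClosed L) (hR : IsClosed R)
    (h : ∀ x ∈ L, Disjoint (connectedComponent x) R) :
    ∃ C : Set X, IsClopen C ∧ L ⊆ C ∧ Disjoint C R := by
  have key : ∀ x ∈ L, ∃ C : Set X, IsClopen C ∧ x ∈ C ∧ Disjoint C R := by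
    intro x hx
    have hx' := h x hx
    rw [connectedComponent_eq_iInter_isClopen, disjoint_comm, disjoint_iff_inter_eq_empty] at hx'
    have : Nonempty {s : Set X // IsClopen s ∧ x ∈ s} := ⟨⟨univ, isClopen_univ, mem_univ x⟩⟩
    obtain ⟨⟨C, hC, hxC⟩, hCR⟩ := hR.isCompact.elim_directed_family_closed
      (fun s : {s : Set X // IsClopen s ∧ x ∈ s} => (s : Set X)) (fun s => s.2.1.1) hx'
      (fun s t => ⟨⟨s.1 ∩ t.1, s.2.1.inter t.2.1, s.2.2, t.2.2⟩,
        inter_subset_left, inter_subset_right⟩)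
    exact ⟨C, hC, hxC, by rwa [disjoint_comm, disjoint_iff_inter_eq_empty]⟩
  choose! C hC hxC hCR using key
  obtain ⟨t, htL, ht, hLt⟩ := hL.isCompact.elim_finite_subcover_image
    (b := L) (c := C) (fun x hx => (hC x hx).2) (fun x hx => mem_biUnion hx (hxC x hx))
  refine ⟨⋃ x ∈ t, C x, ht.isClopen_biUnion fun x hx => hC x (htL hx), hLt, ?_⟩
  simp only [disjoint_iUnion_left]
  exact fun x hx => hCR x (htL hx)

/-- If `B` is compact and no connected subset of `B` meets both `L` and `R`, then `B` is covered by
disjoint open sets `U` and `V` with `B ∩ L ⊆ U` and `B ∩ R ⊆ V`. -/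
theorem IsCompact.exists_open_separation {X : Type*} [TopologicalSpace X] [T2Space X]
    {B L R : Set X} (hB : IsCompact B) (hL : IsClosed L) (hR : IsClosed R)
    (h : ¬ ∃ K ⊆ B, IsConnected K ∧ (K ∩ L).Nonempty ∧ (K ∩ R).Nonempty) :
    ∃ U V : Set X, IsOpen U ∧ IsOpen V ∧ Disjoint U V ∧ B ⊆ U ∪ V ∧ B ∩ L ⊆ U ∧ B ∩ R ⊆ V := by
  have : CompactSpace B := isCompact_iff_compactSpace.1 hB
  obtain ⟨C, hC, hLC, hCR⟩ := exists_isClopen_separating (X := B)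
    (hL.preimage continuous_subtype_val) (hR.preimage continuous_subtype_val) (by
      intro x hx
      rw [Set.disjoint_left]
      intro y hy hyR
      refine h ⟨Subtype.val '' connectedComponent x, by simp,
        isConnected_connectedComponent.image _ continuous_subtype_val.continuousOn, ?_, ?_⟩
      · exact ⟨x, ⟨x, mem_connectedComponent, rfl⟩, hx⟩
      · exact ⟨y, ⟨y, hy, rfl⟩, hyR⟩)
  have h1 : IsCompact (Subtype.val '' C) := hC.1.isCompact.image continuous_subtype_val
  have h2 : IsCompact (Subtype.val '' Cᶜ) :=
    hC.compl.1.isCompact.image continuous_subtype_val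
  obtain ⟨U, V, hU, hV, hCU, hCV, hUV⟩ := SeparatedNhds.of_isCompact_isCompact h1 h2
    ((disjoint_image_iff Subtype.val_injective).2 disjoint_compl_right)
  refine ⟨U, V, hU, hV, hUV, ?_, ?_, ?_⟩
  · intro x hx
    by_cases hxC : (⟨x, hx⟩ : B) ∈ C
    · exact Or.inl (hCU ⟨_, hxC, rfl⟩)
    · exact Or.inr (hCV ⟨_, hxC, rfl⟩)
  · rintro x ⟨hx, hxL⟩
    exact hCU ⟨⟨x, hx⟩, hLC hxL, rfl⟩
  · rintro x ⟨hx, hxR⟩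
    exact hCV ⟨⟨x, hx⟩, fun hxC => Set.disjoint_left.1 hCR hxC hxR, rfl⟩

/-- For a closed relation `Z` with fibres in a fixed compact set, the set of parameters whose fibre
contains a connected set joining `L` to `R` is closed. -/
theorem isClosed_setOf_exists_isConnected {X Y : Type*} [TopologicalSpace X] [TopologicalSpace Y]
    [T2Space Y] {Z : Set (X × Y)} (hZ : IsClosed Z) {Q L R : Set Y} (hQ : IsCompact Q)
    (hZQ : ∀ z ∈ Z, z.2 ∈ Q) (hL : IsClosed L) (hR : IsClosed R) :
    IsClosed {x | ∃ K ⊆ {y | (x, y) ∈ Z},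
      IsConnected K ∧ (K ∩ L).Nonempty ∧ (K ∩ R).Nonempty} := by
  rw [← isOpen_compl_iff, isOpen_iff_mem_nhds]
  intro x hx
  have hB : IsCompact {y | (x, y) ∈ Z} :=
    hQ.of_isClosed_subset (hZ.preimage (Continuous.prodMk_right x)) fun y hy => hZQ _ hy
  obtain ⟨U, V, hU, hV, hUV, hBUV, hBL, hBR⟩ := hB.exists_open_separation hL hR hx
  let O : Set Y := (U ∪ V) ∩ (Lᶜ ∪ U) ∩ (Rᶜ ∪ V)
  have hO : IsOpen O :=
    ((hU.union hV).inter (hL.isOpen_compl.union hU)).inter (hR.isOpen_compl.union hV)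
  have hev : ∀ᶠ x' in nhds x, ∀ y ∈ Q, (x', y) ∈ Zᶜ ∪ Prod.snd ⁻¹' O := by
    refine hQ.eventually_forall_of_forall_eventually fun y _ => ?_
    refine (hZ.isOpen_compl.union (hO.preimage continuous_snd)).mem_nhds ?_
    by_cases hy : (x, y) ∈ Z
    · refine Or.inr ⟨⟨hBUV hy, ?_⟩, ?_⟩
      · by_cases hyL : y ∈ L
        exacts [Or.inr (hBL ⟨hy, hyL⟩), Or.inl hyL]
      · by_cases hyR : y ∈ R
        exacts [Or.inr (hBR ⟨hy, hyR⟩), Or.inl hyR]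
    · exact Or.inl hy
  filter_upwards [hev] with x' hx'
  rintro ⟨K, hK, hKc, ⟨y, hyK, hyL⟩, ⟨z, hzK, hzR⟩⟩
  have hKO : K ⊆ O := fun w hw => (hx' w (hZQ _ (hK hw))).resolve_left fun hn => hn (hK hw)
  have hyU : y ∈ U := (hKO hyK).1.2.resolve_left fun hn => hn hyL
  have hzV : z ∈ V := (hKO hzK).2.resolve_left fun hn => hn hzR
  obtain ⟨w, -, hwU, hwV⟩ := hKc.isPreconnected U V hU hV (fun w hw => (hKO hw).1.1)
    ⟨y, hyK, hyU⟩ ⟨z, hzK, hzV⟩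
  exact Set.disjoint_left.1 hUV hwU hwV

theorem isCompact_rect (a b c d : ℝ) : IsCompact (rect a b c d) := by
  have h : rect a b c d = (EuclideanSpace.equiv (Fin 2) ℝ).toHomeomorph ⁻¹'
      (Icc ![a, c] ![b, d]) := by
    ext x
    simp [rect, Pi.le_def, Fin.forall_fin_two]
    tauto
  rw [h, Homeomorph.isCompact_preimage]
  exact isCompact_Icc

theorem isClosed_setOf_crossing (a b c d : ℝ) (N : ℕ) :
    IsClosed {x : Fin N → Pt | Crossing a b c d (cfgOf x)} := by
  let Z : Set ((Fin N → Pt) × Plane) := {z | z.2 ∈ rect a b c d ∧ isBlue (cfgOf z.1) z.2}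
  have hZ : IsClosed Z := by
    have hZ' : Z = Prod.snd ⁻¹' rect a b c d ∩ ⋃ i : Fin N, ({z | (z.1 i).2 = true} ∩
        ⋂ j : Fin N, {z | dist z.2 (z.1 i).1 ≤ dist z.2 (z.1 j).1}) := by
      ext z
      simp [Z, isBlue, cfgOf]
    rw [hZ']
    refine ((isCompact_rect a b c d).isClosed.preimage continuous_snd).inter
      (isClosed_iUnion_of_finite fun i => IsClosed.inter ?_ (isClosed_iInter fun j => ?_))
    · exact isClosed_eq (by fun_prop) continuous_const
    · exact isClosed_le (by fun_prop) (by fun_prop)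
  have h := isClosed_setOf_exists_isConnected hZ (isCompact_rect a b c d) (fun z hz => hz.1)
    (L := {y : Plane | y 0 = a}) (R := {y : Plane | y 0 = b})
    (isClosed_eq (by fun_prop) continuous_const) (isClosed_eq (by fun_prop) continuous_const)
  exact h

theorem measurable_fR_cfgOf (a b c d : ℝ) (N : ℕ) :
    Measurable fun x : Fin N → Pt => fR a b c d (cfgOf x) := by
  classical
  exact Measurable.ite (isClosed_setOf_crossing a b c d N).measurableSet measurable_const
    measurable_const

section Splitting

open Finset

variable {V : Type*} [Fintype V] [DecidableEq V]

theorem card_colourings_fibre_eq (k : ℕ) (i : Fin k) (A : Finset V) :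
    #{σ : V → Fin k | ({v | σ v = i} : Finset V) = A} = (k - 1) ^ (Fintype.card V - #A) := by
  have h : ({σ : V → Fin k | ({v | σ v = i} : Finset V) = A} : Finset (V → Fin k)) =
      Fintype.piFinset fun v => if v ∈ A then {i} else {i}ᶜ := by
    ext σ
    simp only [Finset.ext_iff, Finset.mem_filter, Finset.mem_univ, true_and, Fintype.mem_piFinset]
    refine forall_congr' fun v => ?_
    split_ifs with hv <;> simp [hv]
  rw [h, Fintype.card_piFinset]
  simp [apply_ite Finset.card, Finset.prod_ite, Finset.card_compl, Finset.filter_not,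
    Finset.card_sdiff]

theorem card_colourings_fibres_eq (k : ℕ) {i j : Fin k} (hij : i ≠ j) {A B : Finset V}
    (hAB : Disjoint A B) :
    #{σ : V → Fin k | ({v | σ v = i} : Finset V) = A ∧ ({v | σ v = j} : Finset V) = B} =
      (k - 2) ^ (Fintype.card V - #A - #B) := by
  have h : ({σ : V → Fin k | ({v | σ v = i} : Finset V) = A ∧ ({v | σ v = j} : Finset V) = B} :
      Finset (V → Fin k)) =
      Fintype.piFinset fun v => if v ∈ A then {i} else if v ∈ B then {j} else {i, j}ᶜ := by
    ext σ
    simp only [Finset.ext_iff, Finset.mem_filter, Finset.mem_univ, true_and, Fintype.mem_piFinset,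
      ← forall_and]
    refine forall_congr' fun v => ?_
    split_ifs with hv hv'
    · have : v ∉ B := Finset.disjoint_left.1 hAB hv
      simp only [hv, this, iff_true, iff_false, Finset.mem_singleton, and_iff_left_iff_imp]
      rintro rfl
      exact hij
    · simp only [hv, hv', iff_true, iff_false, Finset.mem_singleton, and_iff_right_iff_imp]
      rintro rfl
      exact hij.symm
    · simp [hv, hv']
  rw [h, Fintype.card_piFinset]
  have h2 : ∀ v : V, #(if v ∈ A then {i} else if v ∈ B then {j} else ({i, j}ᶜ : Finset (Fin k))) =
      if v ∈ (A ∪ B)ᶜ then k - 2 else 1 := by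
    intro v
    have h3 : #({i, j}ᶜ : Finset (Fin k)) = k - 2 := by
      rw [Finset.card_compl, Finset.card_pair hij, Fintype.card_fin]
    by_cases hA : v ∈ A <;> by_cases hB : v ∈ B <;>
      simp [hA, hB, h3, -Finset.compl_insert]
  simp only [h2]
  rw [Finset.prod_ite_mem]
  simp [-Finset.compl_union, Finset.card_compl, Finset.card_union_of_disjoint hAB, Nat.sub_sub]

theorem sum_colourings_fibre (k : ℕ) (i : Fin k) (φ : Finset V → ℝ) :
    ∑ σ : V → Fin k, φ {v | σ v = i} =
      ∑ A, ((k - 1 : ℕ) : ℝ) ^ (Fintype.card V - #A) * φ A := by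
  rw [← Finset.sum_fiberwise univ (fun σ : V → Fin k => ({v | σ v = i} : Finset V))]
  refine Finset.sum_congr rfl fun A _ => ?_
  rw [← Nat.cast_pow, ← card_colourings_fibre_eq k i A, ← nsmul_eq_mul, ← Finset.sum_const]
  refine Finset.sum_congr rfl fun σ hσ => ?_
  rw [(Finset.mem_filter.1 hσ).2]

/-- The sum of `φ A * φ B` over disjoint pairs of sets, weighted by the number of colourings
of the remaining points with `q` colours. -/
def disjointPairSum (q : ℕ) (φ : Finset V → ℝ) : ℝ :=
  ∑ A, ∑ B ∈ Aᶜ.powerset, (q : ℝ) ^ (Fintype.card V - #A - #B) * (φ A * φ B)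

theorem sum_colourings_fibres (k : ℕ) {i j : Fin k} (hij : i ≠ j) (φ : Finset V → ℝ) :
    ∑ σ : V → Fin k, φ {v | σ v = i} * φ {v | σ v = j} = disjointPairSum (k - 2) φ := by
  rw [← Finset.sum_fiberwise univ (fun σ : V → Fin k => ({v | σ v = i} : Finset V))]
  refine Finset.sum_congr rfl fun A _ => ?_
  rw [← Finset.sum_fiberwise_of_maps_to (t := Aᶜ.powerset)
    (g := fun σ : V → Fin k => ({v | σ v = j} : Finset V))]
  · refine Finset.sum_congr rfl fun B hB => ?_
    have hAB : Disjoint A B :=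
      (Finset.subset_compl_iff_disjoint_left).1 (Finset.mem_powerset.1 hB)
    rw [← Nat.cast_pow, ← card_colourings_fibres_eq k hij hAB, ← nsmul_eq_mul,
      ← Finset.sum_const, Finset.filter_filter]
    refine Finset.sum_congr rfl fun σ hσ => ?_
    rw [(Finset.mem_filter.1 hσ).2.1, (Finset.mem_filter.1 hσ).2.2]
  · intro σ hσ
    rw [← (Finset.mem_filter.1 hσ).2, Finset.mem_powerset]
    intro v hv
    simp only [Finset.mem_filter, Finset.mem_univ, true_and, Finset.mem_compl] at hv ⊢
    rw [hv]
    exact hij.symm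

/-- Second moment bound for the average of `φ` over a `1/k`-thinning, obtained by
splitting the points into `k` colour classes. -/
theorem sq_thinning_average_le (k : ℕ) (hk : 2 ≤ k) (φ : Finset V → ℝ) (hφ : ∀ A, |φ A| ≤ 1) :
    (∑ A, (1 / (k : ℝ)) ^ #A * (1 - 1 / (k : ℝ)) ^ (Fintype.card V - #A) * φ A) ^ 2 ≤
      1 / k + (1 - 1 / k) * ((1 / (k : ℝ)) ^ Fintype.card V * disjointPairSum (k - 2) φ) := by
  have hk0 : (0 : ℝ) < k := by positivity
  set X := ∑ A, (1 / (k : ℝ)) ^ #A * (1 - 1 / (k : ℝ)) ^ (Fintype.card V - #A) * φ A with hX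
  set D := disjointPairSum (k - 2) φ with hD
  set K : ℝ := (k : ℝ) ^ Fintype.card V with hK
  have hK0 : 0 < K := by positivity
  have h1 : ∀ i : Fin k, ∑ σ : V → Fin k, φ {v | σ v = i} = K * X := by
    intro i
    rw [sum_colourings_fibre, hX, Finset.mul_sum]
    refine Finset.sum_congr rfl fun A _ => ?_
    have hA : #A ≤ Fintype.card V := Finset.card_le_univ A
    have e1 : (1 : ℝ) - 1 / k = ((k - 1 : ℕ) : ℝ) / k := by
      rw [Nat.cast_sub (by lia)]
      field_simp
      simp
    have e2 : K = (k : ℝ) ^ #A * (k : ℝ) ^ (Fintype.card V - #A) := by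
      rw [← pow_add, Nat.add_sub_cancel' hA]
    rw [e1, e2, div_pow, div_pow, one_pow]
    field_simp
  have hcard : ((univ : Finset (V → Fin k)).card : ℝ) = K := by simp [hK]
  have h2 : ∀ i : Fin k, ∑ σ : V → Fin k, φ {v | σ v = i} * φ {v | σ v = i} ≤ K := by
    intro i
    calc _ ≤ ∑ σ : V → Fin k, (1 : ℝ) := by
          refine Finset.sum_le_sum fun σ _ => ?_
          rw [← abs_mul_abs_self]
          exact mul_le_one₀ (hφ _) (abs_nonneg _) (hφ _)
      _ = K := by rw [Finset.sum_const, nsmul_eq_mul, mul_one, hcard]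
  have h3 : ∑ σ : V → Fin k, ∑ i, φ {v | σ v = i} = k * (K * X) := by
    rw [Finset.sum_comm, Finset.sum_congr rfl fun i _ => h1 i]
    simp
  have h4 : ∑ σ : V → Fin k, (∑ i, φ {v | σ v = i}) ^ 2 ≤ k * (K + (k - 1) * D) := by
    calc _ = ∑ i : Fin k, ∑ j : Fin k, ∑ σ : V → Fin k, φ {v | σ v = i} * φ {v | σ v = j} := by
          simp_rw [sq, Finset.sum_mul_sum]
          rw [Finset.sum_comm]
          exact Finset.sum_congr rfl fun i _ => Finset.sum_comm
      _ ≤ ∑ i : Fin k, (K + (k - 1) * D) := by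
          refine Finset.sum_le_sum fun i _ => ?_
          rw [← Finset.add_sum_erase _ _ (Finset.mem_univ i)]
          refine add_le_add (h2 i) (le_of_eq ?_)
          rw [Finset.sum_congr rfl fun j hj =>
            sum_colourings_fibres k (Finset.ne_of_mem_erase hj).symm φ]
          rw [Finset.sum_const, Finset.card_erase_of_mem (Finset.mem_univ i), nsmul_eq_mul]
          simp [Nat.cast_sub (show 1 ≤ k by lia), ← hD]
      _ = _ := by simp [mul_add]
  have h5 := sq_sum_le_card_mul_sum_sq (s := univ)
    (f := fun σ : V → Fin k => ∑ i, φ {v | σ v = i})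
  rw [h3, hcard] at h5
  have h6 : (k * (K * X)) ^ 2 ≤ K * (k * (K + (k - 1) * D)) :=
    h5.trans (mul_le_mul_of_nonneg_left h4 hK0.le)
  have h7 : 1 / (k : ℝ) + (1 - 1 / k) * ((1 / (k : ℝ)) ^ Fintype.card V * D) =
      K * (k * (K + (k - 1) * D)) / (k * K) ^ 2 := by
    rw [div_pow, one_pow, ← hK]
    field_simp
  rw [h7, le_div_iff₀ (by positivity)]
  linarith [h6]

end Splitting

section Product

variable {E : Type*} [MeasurableSpace E] (μ : Measure E) [IsProbabilityMeasure μ] {N : ℕ}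

theorem measurePreserving_pi_comp {M : ℕ} {e : Fin M → Fin N} (he : Function.Injective e) :
    MeasurePreserving (fun (x : Fin N → E) i => x (e i))
      (Measure.pi fun _ => μ) (Measure.pi fun _ => μ) := by
  refine ⟨by fun_prop, ?_⟩
  have h : iIndepFun (fun (i : Fin N) (x : Fin N → E) => x i) (Measure.pi fun _ => μ) :=
    iIndepFun_pi (X := fun _ (y : E) => y) fun _ => aemeasurable_id
  rw [iIndepFun.map_fun_eq_pi_map (fun i => (measurable_pi_apply _).aemeasurable)
    (h.precomp he)]
  congr 1
  ext1 i
  exact (measurePreserving_eval (fun _ : Fin N => μ) (e i)).map_eq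

theorem ae_injective_pi [MeasurableEq E] [NullSingletonClass μ] :
    ∀ᵐ x : Fin N → E ∂(Measure.pi fun _ => μ), Function.Injective x := by
  have h : ∀ i j : Fin N, ∀ᵐ x : Fin N → E ∂(Measure.pi fun _ => μ), x i = x j → i = j := by
    intro i j
    by_cases hij : i = j
    · exact .of_forall fun _ _ => hij
    have he : Function.Injective ![i, j] := by
      intro a b
      fin_cases a <;> fin_cases b <;> simp [hij, Ne.symm hij]
    have h1 := (measurePreserving_finTwoArrow μ).comp (measurePreserving_pi_comp μ he)
    have h2 : ∀ᵐ z ∂(μ.prod μ), z.1 ≠ z.2 := by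
      have hm : MeasurableSet {z : E × E | z.1 ≠ z.2} :=
        (measurableSet_eq_fun measurable_fst measurable_snd).compl
      rw [Measure.ae_prod_iff_ae_ae hm]
      refine .of_forall fun z => ?_
      have : {z}ᶜ ∈ ae μ := compl_mem_ae_iff.2 (measure_singleton z)
      filter_upwards [this] with w hw h
      exact hw h.symm
    filter_upwards [h1.quasiMeasurePreserving.ae h2] with x hx hxe
    exact absurd hxe hx
  filter_upwards [ae_all_iff.2 fun i => ae_all_iff.2 (h i)] with x hx i j
  exact hx i j

/-- The points of `x` with index in `A`, listed in increasing order of their indices. -/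
def subtuple (x : Fin N → E) (A : Finset (Fin N)) : Fin A.card → E :=
  fun i => x (A.orderEmbOfFin rfl i)

theorem measurable_subtuple (A : Finset (Fin N)) :
    Measurable fun x : Fin N → E => subtuple x A := by
  unfold subtuple
  fun_prop

theorem integral_subtuple (A : Finset (Fin N)) {F : (Fin A.card → E) → ℝ} (hF : Measurable F) :
    ∫ x, F (subtuple x A) ∂(Measure.pi fun _ => μ) = ∫ x, F x ∂(Measure.pi fun _ => μ) := by
  have h := measurePreserving_pi_comp μ (A.orderEmbOfFin rfl).injective
  rw [← h.map_eq, integral_map h.measurable.aemeasurable hF.aestronglyMeasurable]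
  rfl

theorem integral_subtuple_mul_subtuple {A B : Finset (Fin N)} (hAB : Disjoint A B)
    {F : (Fin A.card → E) → ℝ} (hF : Measurable F) {G : (Fin B.card → E) → ℝ}
    (hG : Measurable G) :
    ∫ x, F (subtuple x A) * G (subtuple x B) ∂(Measure.pi fun _ => μ) =
      (∫ x, F x ∂(Measure.pi fun _ => μ)) * ∫ x, G x ∂(Measure.pi fun _ => μ) := by
  have h : iIndepFun (fun (i : Fin N) (x : Fin N → E) => x i) (Measure.pi fun _ => μ) :=
    iIndepFun_pi (X := fun _ (y : E) => y) fun _ => aemeasurable_id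
  have h1 := h.indepFun_finset A B hAB fun i => by fun_prop
  have h2 := h1.comp
    (φ := fun y => F fun i => y ⟨A.orderEmbOfFin rfl i, A.orderEmbOfFin_mem rfl i⟩)
    (ψ := fun y => G fun i => y ⟨B.orderEmbOfFin rfl i, B.orderEmbOfFin_mem rfl i⟩)
    (hF.comp (by fun_prop)) (hG.comp (by fun_prop))
  rw [← integral_subtuple μ A hF, ← integral_subtuple μ B hG]
  exact h2.integral_fun_mul_eq_mul_integral
    (hF.comp (measurable_subtuple A)).aestronglyMeasurable
    (hG.comp (measurable_subtuple B)).aestronglyMeasurable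

/-- The expectation of `G` at the number of points with a given colour, summed over the colourings
of `M` points with `q + 1` colours. -/
def binomialSum (q : ℕ) (G : ℕ → ℝ) (M : ℕ) : ℝ :=
  ∑ b ∈ Finset.range (M + 1), (M.choose b : ℝ) * ((q : ℝ) ^ (M - b) * G b)

theorem abs_binomialSum_le (q : ℕ) {G : ℕ → ℝ} (hG : ∀ b, |G b| ≤ 1) (M : ℕ) :
    |binomialSum q G M| ≤ ((q : ℝ) + 1) ^ M := by
  rw [add_comm, add_pow]
  refine (Finset.abs_sum_le_sum_abs _ _).trans (Finset.sum_le_sum fun b _ => ?_)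
  rw [abs_mul, abs_mul, abs_of_nonneg (by positivity : (0 : ℝ) ≤ M.choose b),
    abs_of_nonneg (by positivity : (0 : ℝ) ≤ (q : ℝ) ^ (M - b)), one_pow, one_mul, mul_comm]
  exact mul_le_mul_of_nonneg_right (mul_le_of_le_one_right (by positivity) (hG b))
    (by positivity)

variable {F : ∀ M, (Fin M → E) → ℝ}

theorem integrable_subtuple_mul_subtuple (hF : ∀ M, Measurable (F M)) (hF1 : ∀ M x, |F M x| ≤ 1)
    (A B : Finset (Fin N)) :
    Integrable (fun x : Fin N → E => F _ (subtuple x A) * F _ (subtuple x B))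
      (Measure.pi fun _ => μ) := by
  have hm : Measurable fun x : Fin N → E => F _ (subtuple x A) * F _ (subtuple x B) :=
    ((hF _).comp (measurable_subtuple A)).mul ((hF _).comp (measurable_subtuple B))
  refine .of_bound hm.aestronglyMeasurable 1 (.of_forall fun x => ?_)
  rw [Real.norm_eq_abs, abs_mul]
  exact mul_le_one₀ (hF1 _ _) (abs_nonneg _) (hF1 _ _)

theorem integrable_disjointPairSum (hF : ∀ M, Measurable (F M)) (hF1 : ∀ M x, |F M x| ≤ 1)
    (q : ℕ) :
    Integrable (fun x : Fin N → E => disjointPairSum q fun A => F _ (subtuple x A))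
      (Measure.pi fun _ => μ) :=
  integrable_finsetSum _ fun A _ => integrable_finsetSum _ fun B _ =>
    (integrable_subtuple_mul_subtuple μ hF hF1 A B).const_mul _

theorem integral_disjointPairSum (hF : ∀ M, Measurable (F M)) (hF1 : ∀ M x, |F M x| ≤ 1) (q : ℕ)
    {G : ℕ → ℝ} (hG : ∀ M, G M = ∫ x, F M x ∂(Measure.pi fun _ => μ)) :
    ∫ x : Fin N → E, disjointPairSum q (fun A => F _ (subtuple x A)) ∂(Measure.pi fun _ => μ) =
      ∑ a ∈ Finset.range (N + 1), (N.choose a : ℝ) * (G a * binomialSum q G (N - a)) := by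
  have hint : ∀ A B : Finset (Fin N), Integrable (fun x : Fin N → E =>
      (q : ℝ) ^ (Fintype.card (Fin N) - A.card - B.card) *
        (F _ (subtuple x A) * F _ (subtuple x B))) (Measure.pi fun _ => μ) :=
    fun A B => (integrable_subtuple_mul_subtuple μ hF hF1 A B).const_mul _
  unfold disjointPairSum
  rw [integral_finsetSum _ fun A _ => integrable_finsetSum _ fun B _ => hint A B]
  have h : ∀ A : Finset (Fin N), ∫ x : Fin N → E, ∑ B ∈ Aᶜ.powerset,
      (q : ℝ) ^ (Fintype.card (Fin N) - A.card - B.card) *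
        (F _ (subtuple x A) * F _ (subtuple x B)) ∂(Measure.pi fun _ => μ) =
      G A.card * binomialSum q G (N - A.card) := by
    intro A
    rw [integral_finsetSum _ fun B _ => hint A B]
    have h2 := Finset.sum_powerset_apply_card (x := Aᶜ)
      (fun b => (q : ℝ) ^ (N - A.card - b) * G b)
    simp only [Finset.card_compl, Fintype.card_fin, nsmul_eq_mul] at h2
    rw [binomialSum, ← h2, Finset.mul_sum]
    refine Finset.sum_congr rfl fun B hB => ?_
    rw [integral_const_mul, integral_subtuple_mul_subtuple μ
      (Finset.subset_compl_iff_disjoint_left.1 (Finset.mem_powerset.1 hB)) (hF _) (hF _),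
      ← hG, ← hG, Fintype.card_fin]
    ring
  rw [Finset.sum_congr rfl fun A _ => h A, ← Finset.powerset_univ]
  have h2 := Finset.sum_powerset_apply_card (x := (Finset.univ : Finset (Fin N)))
      (fun a => G a * binomialSum q G (N - a))
  simpa only [Finset.card_univ, Fintype.card_fin, nsmul_eq_mul] using h2

end Product

section Poisson

theorem hasSum_pois (r : ℝ) : HasSum (pois r) 1 := by
  have h := (NormedSpace.expSeries_div_hasSum_exp r).mul_left (Real.exp (-r))
  rw [← Real.exp_eq_exp_ℝ, ← Real.exp_add, neg_add_cancel, Real.exp_zero] at h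
  refine h.congr_fun fun N => ?_
  rw [pois, mul_div_assoc]

theorem pois_nonneg {r : ℝ} (hr : 0 ≤ r) (N : ℕ) : 0 ≤ pois r N := by
  unfold pois
  positivity

theorem summable_pois_mul {r : ℝ} (hr : 0 ≤ r) {u : ℕ → ℝ} {C : ℝ} (hu : ∀ N, |u N| ≤ C) :
    Summable fun N => pois r N * u N := by
  refine .of_norm_bounded ((hasSum_pois r).summable.mul_right C) fun N => ?_
  rw [Real.norm_eq_abs, abs_mul, abs_of_nonneg (pois_nonneg hr N)]
  exact mul_le_mul_of_nonneg_left (hu N) (pois_nonneg hr N)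

/-- If `G` is bounded and centred under the Poisson distribution, then distinct colour classes
of a uniformly `k`-coloured Poisson sample are uncorrelated. -/
theorem hasSum_pois_mul_pair {n : ℝ} (hn : 0 ≤ n) {k : ℕ} (hk : 2 ≤ k) {G : ℕ → ℝ}
    (hG1 : ∀ M, |G M| ≤ 1) (hG : ∑' M, pois n M * G M = 0) :
    HasSum (fun N => pois (k * n) N * ((1 / (k : ℝ)) ^ N *
      ∑ a ∈ Finset.range (N + 1), (N.choose a : ℝ) * (G a * binomialSum (k - 2) G (N - a)))) 0 := by
  have hk0 : (k : ℝ) ≠ 0 := by positivity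
  let v : ℕ → ℝ := fun M => n ^ M / M.factorial * binomialSum (k - 2) G M
  have hu : Summable fun M => ‖pois n M * G M‖ := (summable_pois_mul hn hG1).norm
  have hv : Summable fun M => ‖v M‖ := by
    refine .of_nonneg_of_le (fun _ => norm_nonneg _) (fun M => ?_)
      (Real.summable_pow_div_factorial (n * (((k - 2 : ℕ) : ℝ) + 1)))
    have hpos : 0 ≤ n ^ M / M.factorial := by positivity
    rw [norm_mul, Real.norm_eq_abs, Real.norm_eq_abs, abs_of_nonneg hpos, mul_pow,
      mul_div_right_comm]
    exact mul_le_mul_of_nonneg_left (abs_binomialSum_le _ hG1 M) hpos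
  have hsum := (summable_norm_sum_mul_antidiagonal_of_summable_norm hu hv).of_norm.hasSum
  rw [← tsum_mul_tsum_eq_tsum_sum_antidiagonal_of_summable_norm hu hv, hG, zero_mul] at hsum
  have hsum' := hsum.mul_left (Real.exp (-(k * n)) * Real.exp n)
  rw [mul_zero] at hsum'
  refine hsum'.congr_fun fun N => ?_
  rw [Finset.Nat.sum_antidiagonal_eq_sum_range_succ (fun a b => pois n a * G a * v b),
    Finset.mul_sum, Finset.mul_sum, Finset.mul_sum]
  refine Finset.sum_congr rfl fun a ha => ?_
  have haN : a ≤ N := Nat.lt_succ_iff.1 (Finset.mem_range.1 ha)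
  have e1 : n ^ N = n ^ a * n ^ (N - a) := by rw [← pow_add, Nat.add_sub_cancel' haN]
  have e2 : Real.exp (-n) * Real.exp n = 1 := by
    rw [← Real.exp_add, neg_add_cancel, Real.exp_zero]
  simp only [pois, v]
  rw [Nat.cast_choose ℝ haN, mul_pow, e1, one_div, inv_pow]
  have e3 : (N.factorial : ℝ) ≠ 0 := by positivity
  field_simp
  linear_combination (-(n ^ a * n ^ (N - a) * G a * binomialSum (k - 2) G (N - a))) * e2

end Poisson

section PointLaw

theorem volume_Sq : volume Sq = 1 := by
  have h : Sq = (@WithLp.ofLp 2 (Fin 2 → ℝ)) ⁻¹' Icc 0 1 := by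
    ext x
    simp [Sq, Pi.le_def, Fin.forall_fin_two]
    tauto
  rw [h, (PiLp.volume_preserving_ofLp (Fin 2)).measure_preimage
    measurableSet_Icc.nullMeasurableSet, Real.volume_Icc_pi]
  simp

instance : IsProbabilityMeasure (markLaw (1 / 2)) := by
  constructor
  have h : (2⁻¹ : ℝ).toNNReal + (1 - 2⁻¹ : ℝ).toNNReal = 1 := by
    rw [← Real.toNNReal_add (by norm_num) (by norm_num)]
    norm_num
  simp only [markLaw, one_div, Measure.add_apply, Measure.smul_apply, measure_univ,
    ENNReal.smul_def, smul_eq_mul, mul_one]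
  exact_mod_cast h

instance : IsProbabilityMeasure (ptLaw (1 / 2)) := by
  have : IsProbabilityMeasure (volume.restrict Sq) := ⟨by simp [volume_Sq]⟩
  unfold ptLaw
  infer_instance

instance : NullSingletonClass (ptLaw (1 / 2)) := by
  unfold ptLaw
  infer_instance

end PointLaw

theorem cfgOf_subtuple {N : ℕ} (x : Fin N → Pt) (A : Finset (Fin N)) :
    cfgOf (subtuple x A) = x '' A := by
  unfold cfgOf subtuple
  rw [← Function.comp_def, range_comp, Finset.range_orderEmbOfFin]

theorem thinCE_cfgOf (k : ℝ) (f : Config → ℝ) {N : ℕ} {x : Fin N → Pt}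
    (hx : Function.Injective x) :
    thinCE k f (cfgOf x) = ∑ A : Finset (Fin N), (1 / k) ^ A.card *
      (1 - 1 / k) ^ (Fintype.card (Fin N) - A.card) * f (cfgOf (subtuple x A)) := by
  classical
  have hfin : (cfgOf x).Finite := finite_range x
  have h : hfin.toFinset = Finset.univ.image x := by
    ext
    simp [cfgOf]
  rw [thinCE, dif_pos hfin, h, Finset.powerset_image,
    Finset.sum_image (Finset.image_injective hx).injOn, Finset.powerset_univ]
  refine Finset.sum_congr rfl fun A _ => ?_
  rw [Finset.card_image_of_injective _ hx, Finset.card_image_of_injective _ hx, Finset.card_univ,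
    cfgOf_subtuple, Finset.coe_image]

/-- Second moment bound for the conditional expectation given the unthinned configuration. -/
theorem sq_thinCE_sub_le {k : ℕ} (hk : 2 ≤ k) {f : Config → ℝ} {m : ℝ}
    (hf : ∀ η, |f η - m| ≤ 1) {N : ℕ} {x : Fin N → Pt} (hx : Function.Injective x) :
    (thinCE k f (cfgOf x) - m) ^ 2 ≤ 1 / k + (1 - 1 / k) * ((1 / (k : ℝ)) ^ N *
      disjointPairSum (k - 2) fun A => f (cfgOf (subtuple x A)) - m) := by
  have h := sq_thinning_average_le k hk (fun A => f (cfgOf (subtuple x A)) - m) fun A => hf _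
  have hw : ∑ A : Finset (Fin N), (1 / (k : ℝ)) ^ A.card *
      (1 - 1 / (k : ℝ)) ^ (Fintype.card (Fin N) - A.card) = 1 := by
    rw [Fintype.sum_pow_mul_eq_add_pow]
    simp
  simp only [mul_sub, Finset.sum_sub_distrib, ← Finset.sum_mul, hw, one_mul] at h
  rw [← thinCE_cfgOf k f hx, Fintype.card_fin] at h
  simpa only [mul_sub] using h

/-- Chebyshev bound for the conditional expectation `thinCE k f` in the two-stage construction. -/
theorem PE_indicator_le {f : Config → ℝ} (hfm : ∀ N, Measurable fun x : Fin N → Pt => f (cfgOf x))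
    (hf : ∀ η, f η ∈ Icc (0 : ℝ) 1) {n : ℝ} (hn : 0 ≤ n) {k : ℕ} (hk : 2 ≤ k) {t : ℝ} (ht : 0 < t)
    {g : Config → ℝ} (hg : ∀ η, g η ∈ Icc (0 : ℝ) 1)
    (hgt : ∀ η, g η ≠ 0 → t ≤ |thinCE k f η - PE n (1 / 2) f|) :
    PE (k * n) (1 / 2) g ≤ 1 / (t ^ 2 * k) := by
  set m := PE n (1 / 2) f with hm
  have hk0 : (0 : ℝ) < k := by positivity
  have hkn : 0 ≤ k * n := by positivity
  have hint : ∀ N, Integrable (fun x : Fin N → Pt => f (cfgOf x))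
      (Measure.pi fun _ => ptLaw (1 / 2)) := fun N =>
    .of_bound (hfm N).aestronglyMeasurable 1 (.of_forall fun x => by
      rw [Real.norm_eq_abs, abs_of_nonneg (hf _).1]
      exact (hf _).2)
  have habs : ∀ {h : Config → ℝ}, (∀ η, |h η| ≤ 1) → ∀ N,
      |∫ x : Fin N → Pt, h (cfgOf x) ∂(Measure.pi fun _ => ptLaw (1 / 2))| ≤ 1 := fun {h} hh N => by
    have := norm_integral_le_of_norm_le_const (μ := Measure.pi fun _ : Fin N => ptLaw (1 / 2))
      (f := fun x => h (cfgOf x)) (C := 1) (.of_forall fun x => hh (cfgOf x))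
    rwa [probReal_univ, mul_one] at this
  have habs_of_mem : ∀ {h : Config → ℝ}, (∀ η, h η ∈ Icc (0 : ℝ) 1) → ∀ η, |h η| ≤ 1 :=
    fun hh η => abs_le.2 ⟨by linarith [(hh η).1], (hh η).2⟩
  have hsum_f := summable_pois_mul hn (habs (habs_of_mem hf))
  have hm1 : m ∈ Icc (0 : ℝ) 1 := by
    constructor
    · exact tsum_nonneg fun N => mul_nonneg (pois_nonneg hn N)
        (integral_nonneg fun x => (hf _).1)
    · refine le_of_le_of_eq ?_ (hasSum_pois n).tsum_eq
      exact hsum_f.tsum_le_tsum (fun N => mul_le_of_le_one_right (pois_nonneg hn N)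
        (le_of_abs_le (habs (habs_of_mem hf) N))) (hasSum_pois n).summable
  have hfm1 : ∀ η, |f η - m| ≤ 1 := fun η =>
    abs_le.2 ⟨by linarith [(hf η).1, hm1.2], by linarith [(hf η).2, hm1.1]⟩
  let G : ℕ → ℝ := fun N => ∫ x : Fin N → Pt, (f (cfgOf x) - m)
    ∂(Measure.pi fun _ => ptLaw (1 / 2))
  have hG1 : ∀ M, |G M| ≤ 1 := habs hfm1
  have hG : ∑' M, pois n M * G M = 0 := by
    have h1 : ∀ M, pois n M * G M = pois n M * (∫ x : Fin M → Pt, f (cfgOf x)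
        ∂(Measure.pi fun _ => ptLaw (1 / 2))) - pois n M * m := fun M => by
      simp only [G]
      rw [integral_sub (hint M) (integrable_const m), integral_const, probReal_univ, one_smul,
        mul_sub]
    rw [tsum_congr h1, hsum_f.tsum_sub ((hasSum_pois n).summable.mul_right m), tsum_mul_right,
      (hasSum_pois n).tsum_eq, one_mul]
    exact sub_self m
  let T : ℕ → ℝ := fun N => (1 / (k : ℝ)) ^ N *
    ∑ a ∈ Finset.range (N + 1), (N.choose a : ℝ) * (G a * binomialSum (k - 2) G (N - a))
  have hT : HasSum (fun N => pois (k * n) N * T N) 0 := hasSum_pois_mul_pair hn hk hG1 hG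
  have hbound : ∀ N, ∫ x : Fin N → Pt, g (cfgOf x) ∂(Measure.pi fun _ => ptLaw (1 / 2)) ≤
      1 / t ^ 2 * (1 / k + (1 - 1 / k) * T N) := by
    intro N
    have hD := integrable_disjointPairSum (ptLaw (1 / 2)) (N := N)
      (F := fun M x => f (cfgOf x) - m) (fun M => (hfm M).sub_const m) (fun M x => hfm1 _) (k - 2)
    have hD' := integral_disjointPairSum (ptLaw (1 / 2)) (N := N) (G := G)
      (F := fun M x => f (cfgOf x) - m) (fun M => (hfm M).sub_const m) (fun M x => hfm1 _) (k - 2)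
      fun M => rfl
    have hR := ((integrable_const (1 / (k : ℝ))).add
      ((hD.const_mul ((1 / (k : ℝ)) ^ N)).const_mul (1 - 1 / (k : ℝ)))).const_mul (1 / t ^ 2)
    refine (integral_mono_of_nonneg (.of_forall fun x => (hg _).1) hR ?_).trans_eq ?_
    · filter_upwards [ae_injective_pi (ptLaw (1 / 2)) (N := N)] with x hx
      have hsq := sq_thinCE_sub_le hk hfm1 hx
      have hle : g (cfgOf x) ≤ 1 / t ^ 2 * (thinCE k f (cfgOf x) - m) ^ 2 := by
        by_cases h0 : g (cfgOf x) = 0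
        · rw [h0]
          positivity
        · refine (hg _).2.trans ?_
          rw [← sq_abs (_ - m), one_div, ← div_eq_inv_mul, one_le_div (by positivity)]
          exact pow_le_pow_left₀ ht.le (hgt _ h0) 2
      exact hle.trans (mul_le_mul_of_nonneg_left hsq (by positivity))
    · rw [integral_const_mul]
      simp only [Pi.add_apply]
      rw [integral_add (integrable_const _)
        ((hD.const_mul ((1 / (k : ℝ)) ^ N)).const_mul (1 - 1 / (k : ℝ))), integral_const_mul,
        integral_const_mul, hD', integral_const, probReal_univ, one_smul]
  have hRsum : HasSum (fun N => pois (k * n) N * (1 / t ^ 2 * (1 / k + (1 - 1 / k) * T N)))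
      (1 / (t ^ 2 * k)) := by
    convert! (((hasSum_pois (k * n)).mul_right (1 / (k : ℝ))).add
      (hT.mul_left (1 - 1 / (k : ℝ)))).mul_left (1 / t ^ 2) using 1
    · ext N
      ring
    · rw [mul_zero, add_zero, one_mul, one_div_mul_one_div]
  rw [← hRsum.tsum_eq]
  exact (summable_pois_mul hkn (habs (habs_of_mem hg))).tsum_le_tsum
    (fun N => mul_le_mul_of_nonneg_left (hbound N) (pois_nonneg hkn N)) hRsum.summable

/-- **Lemma 3.2.** If the crossing probability at `p = 1/2` is bounded between `c₀` and `1 - c₀`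
for all `n ≥ n₀`, then for `k ≥ 16/c₀⁴` the conditional crossing probability `P[f_R(η) = 1 | η_k]`
in the two-stage construction leaves `[c₀/2, 1 - c₀/2]` with probability at most `1/√k`. -/
theorem conditional_crossing_probability_concentration
    (a b c d : ℝ) (ha : 0 ≤ a) (hab : a < b) (hb : b ≤ 1)
    (hc : 0 ≤ c) (hcd : c < d) (hd : d ≤ 1)
    (c₀ : ℝ) (hc₀ : c₀ ∈ Set.Ioo (0:ℝ) (1/2)) (n₀ : ℝ) (hn₀ : 1 ≤ n₀)
    (hcross : ∀ n : ℝ, n₀ ≤ n → PE n (1/2) (fR a b c d) ∈ Set.Icc c₀ (1 - c₀))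
    (k : ℕ) (hk : 16 / c₀ ^ 4 ≤ (k : ℝ)) (n : ℝ) (hn : n₀ ≤ n) :
    PE ((k : ℝ) * n) (1/2)
        (fun η => if thinCE k (fR a b c d) η ∈ Set.Icc (c₀/2) (1 - c₀/2) then 0 else 1)
      ≤ 1 / Real.sqrt k := by
  have hc0 : 0 < c₀ := hc₀.1
  have hn0 : 0 ≤ n := by linarith
  have hk16 : 16 ≤ c₀ ^ 4 * k := by
    rw [div_le_iff₀ (by positivity)] at hk
    linarith
  have hc4 : c₀ ^ 4 ≤ 1 := pow_le_one₀ hc0.le (by linarith [hc₀.2])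
  have hk16' : (16 : ℝ) ≤ k := hk16.trans (mul_le_of_le_one_left (by positivity) hc4)
  have hk2 : 2 ≤ k := by
    have : 16 ≤ k := by exact_mod_cast hk16'
    lia
  have hm := hcross n hn
  have hfR : ∀ η, fR a b c d η ∈ Icc (0 : ℝ) 1 := by
    intro η
    unfold fR
    split_ifs <;> simp
  refine (PE_indicator_le (t := c₀ / 2) (measurable_fR_cfgOf a b c d) hfR hn0 hk2 (by positivity)
    (fun η => by split_ifs <;> simp) fun η hη => ?_).trans ?_
  · have hη' : thinCE k (fR a b c d) η ∉ Icc (c₀ / 2) (1 - c₀ / 2) := fun h => hη (if_pos h)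
    rw [mem_Icc, not_and_or, not_le, not_le] at hη'
    rcases hη' with h | h
    · exact le_abs.2 (Or.inr (by linarith [hm.1]))
    · exact le_abs.2 (Or.inl (by linarith [hm.2]))
  · have hs : 4 ≤ c₀ ^ 2 * Real.sqrt k := by
      refine abs_le_of_sq_le_sq' ?_ (by positivity) |>.2
      rw [mul_pow, Real.sq_sqrt (by positivity)]
      linarith
    have hs0 : 0 < Real.sqrt k := Real.sqrt_pos.2 (by positivity)
    refine one_div_le_one_div_of_le hs0 ?_
    calc Real.sqrt k ≤ Real.sqrt k * (c₀ ^ 2 * Real.sqrt k / 4) :=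
          le_mul_of_one_le_right hs0.le (by linarith)
      _ = (c₀ / 2) ^ 2 * (Real.sqrt k) ^ 2 := by ring
      _ = (c₀ / 2) ^ 2 * k := by rw [Real.sq_sqrt (by positivity)]
end
end

section
/- (Schramm–Steif revealment bound, Proposition 2.1.) Let f : {0,1}ⁿ → {0,1} and let A be a randomized algorithm that determines f. Then for every p ∈ (0,1), every ε ∈ [0,1] and every integer m ≥ 1: E_p[f(ω) f(ω^ε)] − (E_p[f(ω)])² ≤ e^{−εm} + m² · δ_p(A, [n]). -/
open MeasureTheory Set

noncomputable section

/-- A deterministic decision tree on `{0,1}ⁿ`: internal nodes query a coordinate, with subtrees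
for the two possible values, and leaves output a bit. -/
inductive DTree (n : ℕ) : Type where
  | leaf : Bool → DTree n
  | node : Fin n → DTree n → DTree n → DTree n

/-- Running the decision tree on an input: the output bit. -/
def DTree.eval {n : ℕ} : DTree n → (Fin n → Bool) → Bool
  | .leaf b, _ => b
  | .node i t₁ t₀, ω => if ω i then t₁.eval ω else t₀.eval ω

/-- Running the decision tree on an input: the set of coordinates queried along the way. -/
def DTree.queries {n : ℕ} : DTree n → (Fin n → Bool) → Finset (Fin n)
  | .leaf _, _ => ∅
  | .node i t₁ t₀, ω => insert i (if ω i then t₁.queries ω else t₀.queries ω)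

/-- The Bernoulli(`p`) measure on `Bool`. -/
def berMeasure (p : ℝ) : Measure Bool :=
  p.toNNReal • Measure.dirac true + (1 - p).toNNReal • Measure.dirac false

/-- The product Bernoulli(`p`) measure `P_p` on `{0,1}ⁿ`. -/
def bitsLaw (n : ℕ) (p : ℝ) : Measure (Fin n → Bool) := Measure.pi fun _ => berMeasure p

/-- A randomized algorithm, i.e. a probability distribution over decision trees, sampled
independently of the input. -/
abbrev RandAlg (n : ℕ) : Type := PMF (DTree n)

/-- The randomized algorithm `A` determines `f` if every tree in its support computes `f`. -/
def Determines {n : ℕ} (A : RandAlg n) (f : (Fin n → Bool) → Bool) : Prop :=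
  ∀ T ∈ A.support, ∀ ω, T.eval ω = f ω

/-- The revealment `δ_p(A, k)`: the probability that `A` queries bit `k` on an input drawn
from `P_p`. -/
def revealment {n : ℕ} (A : RandAlg n) (p : ℝ) (k : Fin n) : ℝ :=
  ∑' T : DTree n, (A T).toReal * ((bitsLaw n p) {ω | k ∈ T.queries ω}).toReal

/-- The maximal revealment `δ_p(A, [n]) = max_k δ_p(A, k)`. -/
def maxRevealment {n : ℕ} (A : RandAlg n) (p : ℝ) : ℝ :=
  ⨆ k : Fin n, revealment A p k

/-- The real-valued indicator of a Boolean function. -/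
def fI {n : ℕ} (f : (Fin n → Bool) → Bool) (ω : Fin n → Bool) : ℝ := if f ω then 1 else 0

/-- Joint expectation of `g (ω, ω^ε)` where `ω ~ P_p` and `ω^ε` is obtained from `ω` by
resampling each coordinate independently with probability `ε` (from Bernoulli(`p`)). -/
def pertExpB (n : ℕ) (p ε : ℝ) (g : (Fin n → Bool) → (Fin n → Bool) → ℝ) : ℝ :=
  ∫ ω, ∫ ω', ∫ u : Fin n → ℝ,
      g ω (fun i => if u i < ε then ω' i else ω i)
    ∂(Measure.pi fun _ => unif01) ∂(bitsLaw n p) ∂(bitsLaw n p)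

namespace BiasedCube

open Finset

variable {n : ℕ} {p : ℝ}

/-- The Bernoulli(`p`) weight of a bit. -/
def bitWeight (p : ℝ) (b : Bool) : ℝ := if b then p else 1 - p

/-- The Bernoulli(`p`) weight of a bit string. -/
def weight (p : ℝ) (ω : Fin n → Bool) : ℝ := ∏ i, bitWeight p (ω i)

/-- The expectation under the product Bernoulli(`p`) law, as a finite sum. -/
def expect (p : ℝ) (g : (Fin n → Bool) → ℝ) : ℝ := ∑ ω, weight p ω * g ω

/-- The centred and normalised bit. -/
def bitChar (p : ℝ) (b : Bool) : ℝ := if b then √((1 - p) / p) else -√(p / (1 - p))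

/-- The `p`-biased Walsh characters. -/
def chi (p : ℝ) (S : Finset (Fin n)) (ω : Fin n → Bool) : ℝ := ∏ i ∈ S, bitChar p (ω i)

/-- The `p`-biased Fourier–Walsh coefficients. -/
def coef (p : ℝ) (f : (Fin n → Bool) → ℝ) (S : Finset (Fin n)) : ℝ :=
  expect p fun ω => f ω * chi p S ω

lemma bitWeight_pos (hp : p ∈ Set.Ioo (0 : ℝ) 1) (b : Bool) : 0 < bitWeight p b := by
  cases b <;> simp [bitWeight, hp.1, hp.2]

lemma weight_pos (hp : p ∈ Set.Ioo (0 : ℝ) 1) (ω : Fin n → Bool) : 0 < weight p ω :=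
  prod_pos fun _ _ => bitWeight_pos hp _

lemma sum_bitWeight : ∑ b, bitWeight p b = 1 := by simp [bitWeight]

lemma sum_bitWeight_mul_bitChar (hp : p ∈ Set.Ioo (0 : ℝ) 1) :
    ∑ b, bitWeight p b * bitChar p b = 0 := by
  obtain ⟨h0, h1⟩ := hp
  have h1' : 0 < 1 - p := by linarith
  have ha : p * √((1 - p) / p) = √(p * (1 - p)) := by
    rw [← Real.sqrt_sq h0.le, ← Real.sqrt_mul (by positivity), Real.sqrt_sq h0.le]
    congr 1; field_simp
  have hb : (1 - p) * √(p / (1 - p)) = √(p * (1 - p)) := by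
    conv_lhs => rw [← Real.sqrt_sq h1'.le, ← Real.sqrt_mul (by positivity), Real.sqrt_sq h1'.le]
    congr 1; field_simp
  simp [bitWeight, bitChar, ha, hb]

lemma sum_bitWeight_mul_bitChar_sq (hp : p ∈ Set.Ioo (0 : ℝ) 1) :
    ∑ b, bitWeight p b * bitChar p b ^ 2 = 1 := by
  obtain ⟨h0, h1⟩ := hp
  have h1' : 0 < 1 - p := by linarith
  have ha : √((1 - p) / p) ^ 2 = (1 - p) / p := Real.sq_sqrt (by positivity)
  have hb : √(p / (1 - p)) ^ 2 = p / (1 - p) := Real.sq_sqrt (by positivity)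
  simp only [Fintype.sum_bool, bitWeight, bitChar, if_true, Bool.false_eq_true, if_false, neg_sq,
    ha, hb]
  field_simp
  ring

lemma bitWeight_mul_kernel (hp : p ∈ Set.Ioo (0 : ℝ) 1) (a b : Bool) :
    bitWeight p b * (1 + bitChar p a * bitChar p b) = if a = b then 1 else 0 := by
  obtain ⟨h0, h1⟩ := hp
  have h1' : 0 < 1 - p := by linarith
  have ha : √((1 - p) / p) * √((1 - p) / p) = (1 - p) / p := Real.mul_self_sqrt (by positivity)
  have hb : √(p / (1 - p)) * √(p / (1 - p)) = p / (1 - p) := Real.mul_self_sqrt (by positivity)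
  have hab : √((1 - p) / p) * √(p / (1 - p)) = 1 := by
    rw [← Real.sqrt_mul (by positivity), Real.sqrt_eq_one]
    field_simp
  have hba : √(p / (1 - p)) * √((1 - p) / p) = 1 := by rw [mul_comm, hab]
  cases a <;> cases b <;> simp [bitWeight, bitChar, ha, hb, hab, hba]
  · field_simp
    ring
  · field_simp
    ring

lemma expect_prod (h : Fin n → Bool → ℝ) :
    expect p (fun ω => ∏ i, h i (ω i)) = ∏ i, ∑ b, bitWeight p b * h i b := by
  simp only [expect, weight, ← prod_mul_distrib]
  rw [prod_univ_sum, Fintype.piFinset_univ]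

lemma expect_add (g h : (Fin n → Bool) → ℝ) :
    expect p (fun ω => g ω + h ω) = expect p g + expect p h := by
  simp [expect, mul_add, sum_add_distrib]

lemma expect_const_mul (c : ℝ) (g : (Fin n → Bool) → ℝ) :
    expect p (fun ω => c * g ω) = c * expect p g := by
  simp only [expect, mul_sum]
  exact sum_congr rfl fun _ _ => by ring

lemma expect_sum {ι : Type*} (s : Finset ι) (g : ι → (Fin n → Bool) → ℝ) :
    expect p (fun ω => ∑ j ∈ s, g j ω) = ∑ j ∈ s, expect p (g j) := by
  simp only [expect, mul_sum]
  exact sum_comm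

lemma expect_mono (hp : p ∈ Set.Ioo (0 : ℝ) 1) {g h : (Fin n → Bool) → ℝ} (hgh : ∀ ω, g ω ≤ h ω) :
    expect p g ≤ expect p h :=
  sum_le_sum fun ω _ => mul_le_mul_of_nonneg_left (hgh ω) (weight_pos hp ω).le

lemma expect_const (c : ℝ) : expect p (fun _ : Fin n → Bool => c) = c := by
  have h := expect_prod (n := n) (p := p) fun _ _ => 1
  simp only [prod_const_one, mul_one, sum_bitWeight] at h
  simpa [h] using expect_const_mul (p := p) c fun _ : Fin n → Bool => 1

lemma sq_expect_mul_le (hp : p ∈ Set.Ioo (0 : ℝ) 1) (g h : (Fin n → Bool) → ℝ) :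
    expect p (fun ω => g ω * h ω) ^ 2 ≤
      expect p (fun ω => g ω ^ 2) * expect p (fun ω => h ω ^ 2) := by
  have key := sum_mul_sq_le_sq_mul_sq univ (fun ω => √(weight p ω) * g ω)
    fun ω => √(weight p ω) * h ω
  have hs : ∀ ω : Fin n → Bool, √(weight p ω) * √(weight p ω) = weight p ω := fun ω =>
    Real.mul_self_sqrt (weight_pos hp ω).le
  have hm : ∀ ω, √(weight p ω) * g ω * (√(weight p ω) * h ω) = weight p ω * (g ω * h ω) :=
    fun ω => by rw [mul_mul_mul_comm, hs]
  simp only [hm, mul_pow, sq √_, hs] at key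
  exact key

lemma chi_empty (ω : Fin n → Bool) : chi p ∅ ω = 1 := rfl

lemma chi_eq_prod (S : Finset (Fin n)) (ω : Fin n → Bool) :
    chi p S ω = ∏ i, if i ∈ S then bitChar p (ω i) else 1 := by
  rw [prod_ite_mem, Finset.univ_inter, chi]

lemma expect_chi_mul_chi (hp : p ∈ Set.Ioo (0 : ℝ) 1) (S T : Finset (Fin n)) :
    expect p (fun ω => chi p S ω * chi p T ω) = if S = T then 1 else 0 := by
  simp only [chi_eq_prod, ← prod_mul_distrib]
  rw [expect_prod fun i b => (if i ∈ S then bitChar p b else 1) * if i ∈ T then bitChar p b else 1]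
  have h : ∀ i, (∑ b, bitWeight p b *
      ((if i ∈ S then bitChar p b else 1) * if i ∈ T then bitChar p b else 1)) =
      if (i ∈ S ↔ i ∈ T) then 1 else 0 := by
    intro i
    by_cases hS : i ∈ S <;> by_cases hT : i ∈ T <;>
      simp only [hS, hT, if_true, if_false, mul_one, one_mul, iff_true, iff_false, not_true]
    · simpa only [sq] using sum_bitWeight_mul_bitChar_sq hp
    · exact sum_bitWeight_mul_bitChar hp
    · exact sum_bitWeight_mul_bitChar hp
    · exact sum_bitWeight
  simp only [h]
  rw [Finset.prod_boole]
  simp [Finset.ext_iff]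

lemma fourier_expansion (hp : p ∈ Set.Ioo (0 : ℝ) 1) (f : (Fin n → Bool) → ℝ) (ω : Fin n → Bool) :
    f ω = ∑ S, coef p f S * chi p S ω := by
  have hk : ∀ ω', weight p ω' * ∑ S, chi p S ω * chi p S ω' = if ω = ω' then 1 else 0 := by
    intro ω'
    simp only [chi, ← prod_mul_distrib]
    rw [← Finset.powerset_univ, ← prod_one_add, weight, ← prod_mul_distrib]
    simp only [bitWeight_mul_kernel hp]
    rw [Finset.prod_boole]
    simp [funext_iff]
  simp only [coef, expect, sum_mul]
  rw [sum_comm]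
  calc f ω = ∑ ω', f ω' * if ω = ω' then 1 else 0 := by simp
    _ = _ := sum_congr rfl fun ω' _ => by
      rw [← hk, mul_sum, mul_sum]
      exact sum_congr rfl fun _ _ => by ring

lemma expect_mul_eq_sum (hp : p ∈ Set.Ioo (0 : ℝ) 1) (f g : (Fin n → Bool) → ℝ) :
    expect p (fun ω => f ω * g ω) = ∑ S, coef p g S * coef p f S := by
  calc expect p (fun ω => f ω * g ω)
      = expect p (fun ω => ∑ S, coef p g S * (f ω * chi p S ω)) := by
        congr 1; ext ω
        conv_lhs => rw [fourier_expansion hp g ω, mul_sum]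
        exact sum_congr rfl fun _ _ => by ring
    _ = _ := by
        rw [expect_sum]
        exact sum_congr rfl fun S _ => expect_const_mul _ _

lemma parseval (hp : p ∈ Set.Ioo (0 : ℝ) 1) (f : (Fin n → Bool) → ℝ) :
    expect p (fun ω => f ω ^ 2) = ∑ S, coef p f S ^ 2 := by
  simpa only [sq] using expect_mul_eq_sum hp f f

lemma coef_sum_chi (hp : p ∈ Set.Ioo (0 : ℝ) 1) (F : Finset (Finset (Fin n)))
    (a : Finset (Fin n) → ℝ) (S : Finset (Fin n)) :
    coef p (fun ω => ∑ T ∈ F, a T * chi p T ω) S = if S ∈ F then a S else 0 := by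
  simp only [coef, sum_mul, expect_sum, mul_assoc, expect_const_mul, expect_chi_mul_chi hp]
  simp

/-- The input that agrees with `ω` on `J` and with `ω'` elsewhere. -/
def splice (J : Finset (Fin n)) (ω ω' : Fin n → Bool) : Fin n → Bool :=
  fun i => if i ∈ J then ω i else ω' i

lemma chi_splice (J T : Finset (Fin n)) (ω ω' : Fin n → Bool) :
    chi p T (splice J ω ω') = chi p (T ∩ J) ω * chi p (T \ J) ω' := by
  simp only [chi_eq_prod, ← prod_mul_distrib]
  refine prod_congr rfl fun i _ => ?_
  by_cases hT : i ∈ T <;> by_cases hJ : i ∈ J <;> simp [splice, hT, hJ]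

lemma coef_level_splice (hp : p ∈ Set.Ioo (0 : ℝ) 1) {k : ℕ} (a : Finset (Fin n) → ℝ)
    (J : Finset (Fin n)) (ω : Fin n → Bool) {S : Finset (Fin n)} (hS : #S = k) :
    coef p (fun ω' => ∑ T with #T = k, a T * chi p T (splice J ω ω')) S =
      if Disjoint S J then a S else 0 := by
  simp only [chi_splice, coef, sum_mul, expect_sum, mul_assoc, expect_const_mul,
    expect_chi_mul_chi hp]
  have h : ∀ T ∈ ({T | #T = k} : Finset (Finset (Fin n))),
      a T * (chi p (T ∩ J) ω * if T \ J = S then 1 else 0) =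
        if T = S then (if Disjoint S J then a S else 0) else 0 := by
    intro T hT
    have hT : #T = k := by simpa using hT
    by_cases hTS : T = S
    · subst hTS
      by_cases hd : Disjoint T J
      · simp [hd, Finset.sdiff_eq_self_iff_disjoint.2 hd, disjoint_iff_inter_eq_empty.1 hd, chi_empty]
      · simp [hd]
    · have : T \ J ≠ S := fun h => hTS (eq_of_subset_of_card_le (h ▸ Finset.sdiff_subset)
        (by omega)).symm
      simp [hTS, this]
  rw [sum_congr rfl h]
  simp [hS]

/-- Bessel's inequality for the mean and the level-`k` coefficients. -/
lemma sq_expect_add_level_le (hp : p ∈ Set.Ioo (0 : ℝ) 1) {k : ℕ} (hk : k ≠ 0)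
    (h : (Fin n → Bool) → ℝ) :
    expect p h ^ 2 + ∑ S with #S = k, coef p h S ^ 2 ≤ expect p (fun ω => h ω ^ 2) := by
  rw [parseval hp]
  have h0 : expect p h = coef p h ∅ := by simp [coef, chi_empty]
  rw [h0, ← sum_insert (f := fun S => coef p h S ^ 2) (by simp [hk.symm])]
  exact sum_le_sum_of_subset_of_nonneg (subset_univ _) fun _ _ _ => sq_nonneg _

section DecisionTree

lemma eval_queries_congr (T : DTree n) {ω ω' : Fin n → Bool} (h : ∀ i ∈ T.queries ω, ω' i = ω i) :
    T.eval ω' = T.eval ω ∧ T.queries ω' = T.queries ω := by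
  induction T with
  | leaf b => exact ⟨rfl, rfl⟩
  | node i t₁ t₀ ih₁ ih₀ =>
    simp only [DTree.queries, Finset.mem_insert, forall_eq_or_imp] at h
    obtain ⟨hi, h⟩ := h
    simp only [DTree.eval, DTree.queries, hi]
    cases hω : ω i
    · simp only [hω, Bool.false_eq_true, if_false] at h ⊢
      exact ⟨(ih₀ h).1, by rw [(ih₀ h).2]⟩
    · simp only [hω, if_true] at h ⊢
      exact ⟨(ih₁ h).1, by rw [(ih₁ h).2]⟩

lemma eval_queries_splice (T : DTree n) (ω ω' : Fin n → Bool) :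
    T.eval (splice (T.queries ω) ω ω') = T.eval ω ∧
      T.queries (splice (T.queries ω) ω ω') = T.queries ω :=
  eval_queries_congr T fun i hi => by simp [splice, hi]

/-- Exchanging the bits of two inputs outside the set queried on the first one. -/
def exchange (T : DTree n) (x : (Fin n → Bool) × (Fin n → Bool)) :
    (Fin n → Bool) × (Fin n → Bool) :=
  (splice (T.queries x.1) x.1 x.2, splice (T.queries x.1) x.2 x.1)

lemma exchange_involutive (T : DTree n) : Function.Involutive (exchange T) := by
  rintro ⟨ω, ω'⟩
  simp only [exchange, (eval_queries_splice T ω ω').2]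
  ext i <;> by_cases hi : i ∈ T.queries ω <;> simp [splice, hi]

lemma weight_splice_mul (J : Finset (Fin n)) (ω ω' : Fin n → Bool) :
    weight p (splice J ω ω') * weight p (splice J ω' ω) = weight p ω * weight p ω' := by
  simp only [weight, ← prod_mul_distrib]
  refine prod_congr rfl fun i _ => ?_
  by_cases hi : i ∈ J <;> simp [splice, hi, mul_comm]

/-- Resampling the bits that a decision tree does not query preserves the law of the input. -/
lemma expect_expect_splice (T : DTree n) (g : (Fin n → Bool) → ℝ) :
    expect p (fun ω => expect p fun ω' => g (splice (T.queries ω) ω ω')) = expect p g := by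
  have h : expect p g = expect p (fun ω => expect p fun _ : Fin n → Bool => g ω) := by
    simp only [expect_const]
  rw [h]
  simp only [expect, mul_sum, ← mul_assoc]
  simp only [← Fintype.sum_prod_type']
  rw [← Equiv.sum_comp ((exchange_involutive T).toPerm _)
    fun x => weight p x.1 * weight p x.2 * g x.1]
  refine sum_congr rfl fun x _ => ?_
  simp only [Function.Involutive.coe_toPerm, exchange]
  rw [weight_splice_mul]

/-- The level-`k` weight of a function computed by a decision tree `T` is controlled by the
probabilities that `T` queries a bit of a given set. -/
lemma sq_level_weight_le (hp : p ∈ Set.Ioo (0 : ℝ) 1) {k : ℕ} (hk : k ≠ 0) (T : DTree n)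
    (f : (Fin n → Bool) → ℝ) (hf : ∀ ω ω', f (splice (T.queries ω) ω ω') = f ω) :
    (∑ S with #S = k, coef p f S ^ 2) ^ 2 ≤ expect p (fun ω => f ω ^ 2) *
      ∑ S with #S = k, coef p f S ^ 2 *
        ∑ i ∈ S, expect p (fun ω => if i ∈ T.queries ω then 1 else 0) := by
  set F : Finset (Finset (Fin n)) := {S | #S = k} with hF
  set g : (Fin n → Bool) → ℝ := fun ω => ∑ S ∈ F, coef p f S * chi p S ω with hg
  set M : (Fin n → Bool) → ℝ := fun ω => expect p fun ω' => g (splice (T.queries ω) ω ω') with hM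
  have hW : ∑ S ∈ F, coef p f S ^ 2 = expect p (fun ω => f ω * M ω) := by
    have h1 : expect p (fun ω => f ω * g ω) = ∑ S ∈ F, coef p f S ^ 2 := by
      rw [expect_mul_eq_sum hp, hg]
      simp only [coef_sum_chi hp, ite_mul, zero_mul, sum_ite_mem, Finset.univ_inter, sq]
    rw [← h1, ← expect_expect_splice T]
    simp only [hf, expect_const_mul, hM]
  have hg2 : expect p (fun ω => g ω ^ 2) = ∑ S ∈ F, coef p f S ^ 2 := by
    rw [parseval hp, hg]
    simp only [coef_sum_chi hp, ite_pow, zero_pow two_ne_zero, sum_ite_mem, Finset.univ_inter]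
  have hbessel : expect p (fun ω => M ω ^ 2) + ∑ S ∈ F, coef p f S ^ 2 *
      expect p (fun ω => if Disjoint S (T.queries ω) then 1 else 0) ≤
      ∑ S ∈ F, coef p f S ^ 2 := by
    rw [← hg2, ← expect_expect_splice T (fun ω => g ω ^ 2)]
    simp only [← expect_const_mul]
    rw [← expect_sum, ← expect_add]
    refine expect_mono hp fun ω => ?_
    refine le_trans (le_of_eq ?_) (sq_expect_add_level_le hp hk _)
    congr 1
    refine sum_congr rfl fun S hS => ?_
    rw [hg, coef_level_splice hp _ _ _ (by simpa [hF] using hS)]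
    split_ifs <;> simp
  rw [hW]
  refine (sq_expect_mul_le hp f M).trans (mul_le_mul_of_nonneg_left ?_ ?_)
  · refine (le_sub_iff_add_le.2 hbessel).trans ?_
    rw [← sum_sub_distrib]
    refine sum_le_sum fun S _ => ?_
    rw [← mul_one_sub]
    refine mul_le_mul_of_nonneg_left ?_ (sq_nonneg _)
    rw [sub_le_iff_le_add, ← expect_sum, ← expect_add]
    refine (expect_const (n := n) (p := p) 1).symm.le.trans (expect_mono hp fun ω => ?_)
    by_cases hd : Disjoint S (T.queries ω)
    · simp only [hd, if_true, le_add_iff_nonneg_left]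
      exact sum_nonneg fun _ _ => by split_ifs <;> norm_num
    · obtain ⟨i, hiS, hiT⟩ := Finset.not_disjoint_iff.1 hd
      simp only [hd, if_false, add_zero]
      refine le_trans ?_ (single_le_sum (fun _ _ => by split_ifs <;> norm_num) hiS)
      simp [hiT]
  · rw [parseval hp]
    exact sum_nonneg fun _ _ => sq_nonneg _

end DecisionTree

section Law

instance : IsFiniteMeasure (berMeasure p) := by
  unfold berMeasure; infer_instance

instance : IsFiniteMeasure (bitsLaw n p) := by
  unfold bitsLaw; infer_instance

lemma berMeasure_real_singleton (hp : p ∈ Set.Ioo (0 : ℝ) 1) (b : Bool) :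
    (berMeasure p).real {b} = bitWeight p b := by
  have h1 : 0 ≤ 1 - p := by linarith [hp.2]
  rw [Measure.real]
  cases b <;> simp [berMeasure, bitWeight, hp.1.le, h1]

lemma integral_bitsLaw (hp : p ∈ Set.Ioo (0 : ℝ) 1) (g : (Fin n → Bool) → ℝ) :
    ∫ ω, g ω ∂bitsLaw n p = expect p g := by
  rw [integral_fintype Integrable.of_finite]
  refine sum_congr rfl fun ω _ => ?_
  rw [Measure.real, bitsLaw, Measure.pi_singleton, ENNReal.toReal_prod, smul_eq_mul, weight]
  simp only [← berMeasure_real_singleton hp, Measure.real]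

lemma bitsLaw_toReal (hp : p ∈ Set.Ioo (0 : ℝ) 1) (P : (Fin n → Bool) → Prop) [DecidablePred P] :
    (bitsLaw n p {ω | P ω}).toReal = expect p (fun ω => if P ω then 1 else 0) := by
  rw [← integral_bitsLaw hp, ← Measure.real,
    ← integral_indicator_one (Set.toFinite {ω | P ω}).measurableSet]
  congr 1
  ext ω
  simp [Set.indicator_apply]

instance : IsProbabilityMeasure unif01 := ⟨by simp [unif01]⟩

lemma ite_lt_eq_indicator_add (ε a b : ℝ) : (fun u : ℝ => if u < ε then a else b) =
    fun u => (Set.Iio ε).indicator (fun _ => a - b) u + b := by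
  ext u
  by_cases hu : u < ε <;> simp [hu]

lemma integrable_ite_lt (ε a b : ℝ) : Integrable (fun u => if u < ε then a else b) unif01 := by
  rw [ite_lt_eq_indicator_add]
  exact ((integrable_const _).indicator measurableSet_Iio).add (integrable_const _)

lemma integral_ite_lt {ε : ℝ} (hε : ε ∈ Set.Icc (0 : ℝ) 1) (a b : ℝ) :
    ∫ u, (if u < ε then a else b) ∂unif01 = ε * a + (1 - ε) * b := by
  have hv : unif01.real (Set.Iio ε) = ε := by
    rw [unif01, measureReal_restrict_apply measurableSet_Iio]
    have : Set.Iio ε ∩ Set.Icc 0 1 = Set.Ico 0 ε := by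
      ext x
      simp only [Set.mem_inter_iff, Set.mem_Iio, Set.mem_Icc, Set.mem_Ico]
      constructor
      · rintro ⟨h1, h2, h3⟩; exact ⟨h2, h1⟩
      · rintro ⟨h1, h2⟩; exact ⟨h2, h1, by linarith [hε.2]⟩
    rw [this]
    simp [hε.1]
  rw [ite_lt_eq_indicator_add, integral_add ((integrable_const _).indicator measurableSet_Iio) (integrable_const _),
    integral_indicator_const _ measurableSet_Iio, hv]
  simp
  ring

end Law

/-- The pointwise value of a character at the perturbed input, as a product over coordinates. -/
lemma chi_perturb (S : Finset (Fin n)) (ε : ℝ) (ω ω' : Fin n → Bool) (u : Fin n → ℝ) :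
    chi p S (fun i => if u i < ε then ω' i else ω i) =
      ∏ i, if u i < ε then (if i ∈ S then bitChar p (ω' i) else 1)
        else (if i ∈ S then bitChar p (ω i) else 1) := by
  rw [chi_eq_prod]
  refine prod_congr rfl fun i _ => ?_
  split_ifs <;> rfl

lemma integrable_chi_perturb (S : Finset (Fin n)) (ε : ℝ) (ω ω' : Fin n → Bool) :
    Integrable (fun u : Fin n → ℝ => chi p S (fun i => if u i < ε then ω' i else ω i))
      (Measure.pi fun _ => unif01) := by
  simp only [chi_perturb]
  exact Integrable.fintype_prod (f := fun i u => if u < ε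
    then (if i ∈ S then bitChar p (ω' i) else 1) else (if i ∈ S then bitChar p (ω i) else 1))
    fun i => integrable_ite_lt _ _ _

lemma integral_chi_perturb (S : Finset (Fin n)) {ε : ℝ} (hε : ε ∈ Set.Icc (0 : ℝ) 1)
    (ω ω' : Fin n → Bool) :
    ∫ u : Fin n → ℝ, chi p S (fun i => if u i < ε then ω' i else ω i)
      ∂(Measure.pi fun _ => unif01) =
    ∏ i, (ε * (if i ∈ S then bitChar p (ω' i) else 1) +
      (1 - ε) * (if i ∈ S then bitChar p (ω i) else 1)) := by
  simp only [chi_perturb, ← integral_ite_lt hε]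
  exact integral_fintype_prod_eq_prod (fun i u => if u < ε
    then (if i ∈ S then bitChar p (ω' i) else 1) else (if i ∈ S then bitChar p (ω i) else 1))

lemma expect_integral_chi_perturb (hp : p ∈ Set.Ioo (0 : ℝ) 1) (S : Finset (Fin n)) {ε : ℝ}
    (hε : ε ∈ Set.Icc (0 : ℝ) 1) (ω : Fin n → Bool) :
    expect p (fun ω' => ∫ u : Fin n → ℝ, chi p S (fun i => if u i < ε then ω' i else ω i)
      ∂(Measure.pi fun _ => unif01)) = (1 - ε) ^ #S * chi p S ω := by
  simp only [integral_chi_perturb S hε]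
  rw [expect_prod fun i b => ε * (if i ∈ S then bitChar p b else 1) +
      (1 - ε) * (if i ∈ S then bitChar p (ω i) else 1), chi, ← prod_const, ← prod_mul_distrib,
    ← Finset.univ_inter S, ← prod_ite_mem]
  refine prod_congr rfl fun i _ => ?_
  have hsplit : ∀ x : Bool → ℝ, ∀ y : ℝ, ∑ b, bitWeight p b * (ε * x b + (1 - ε) * y) =
      ε * ∑ b, bitWeight p b * x b + (1 - ε) * y * ∑ b, bitWeight p b := by
    intro x y
    simp only [Fintype.sum_bool]
    ring
  rw [hsplit, sum_bitWeight]
  by_cases hi : i ∈ S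
  · simp only [hi, if_true, sum_bitWeight_mul_bitChar hp, Finset.univ_inter]
    ring
  · simp only [hi, if_false, mul_one, sum_bitWeight, Finset.univ_inter]
    ring

/-- The noise correlation in terms of the Fourier–Walsh coefficients. -/
lemma pertExpB_mul (hp : p ∈ Set.Ioo (0 : ℝ) 1) {ε : ℝ} (hε : ε ∈ Set.Icc (0 : ℝ) 1)
    (f : (Fin n → Bool) → ℝ) :
    pertExpB n p ε (fun ω ω' => f ω * f ω') = ∑ S, (1 - ε) ^ #S * coef p f S ^ 2 := by
  have hinner : ∀ ω ω' : Fin n → Bool,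
      ∫ u : Fin n → ℝ, f ω * f (fun i => if u i < ε then ω' i else ω i)
        ∂(Measure.pi fun _ => unif01) =
      ∑ S, f ω * coef p f S * ∫ u : Fin n → ℝ, chi p S (fun i => if u i < ε then ω' i else ω i)
        ∂(Measure.pi fun _ => unif01) := by
    intro ω ω'
    simp only [← integral_const_mul]
    rw [← integral_finsetSum _ fun S _ => (integrable_chi_perturb S ε ω ω').const_mul _]
    congr 1
    ext u
    rw [fourier_expansion hp f fun i => if u i < ε then ω' i else ω i, mul_sum]
    exact sum_congr rfl fun _ _ => by ring
  simp only [pertExpB, integral_bitsLaw hp, hinner, expect_sum, expect_const_mul,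
    expect_integral_chi_perturb hp _ hε]
  refine sum_congr rfl fun S _ => ?_
  calc _ = expect p (fun ω => (1 - ε) ^ #S * coef p f S * (f ω * chi p S ω)) :=
        congrArg _ (funext fun ω => by ring)
    _ = (1 - ε) ^ #S * coef p f S * coef p f S := expect_const_mul _ _
    _ = _ := by ring

section Revealment

lemma summable_toReal_pmf {α : Type*} (A : PMF α) : Summable fun a => (A a).toReal :=
  ENNReal.summable_toReal A.tsum_coe_ne_top

lemma tsum_toReal_pmf {α : Type*} (A : PMF α) : ∑' a, (A a).toReal = 1 := by
  rw [← ENNReal.tsum_toReal_eq A.apply_ne_top, A.tsum_coe, ENNReal.toReal_one]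

lemma summable_revealment (hp : p ∈ Set.Ioo (0 : ℝ) 1) (A : RandAlg n) (k : Fin n) :
    Summable fun T : DTree n => (A T).toReal * (bitsLaw n p {ω | k ∈ T.queries ω}).toReal := by
  refine (summable_toReal_pmf A).of_nonneg_of_le (fun _ => by positivity) fun T =>
    mul_le_of_le_one_right ENNReal.toReal_nonneg ?_
  rw [bitsLaw_toReal hp]
  refine (expect_mono hp fun ω => ?_).trans (expect_const (n := n) (p := p) 1).le
  split_ifs <;> norm_num

lemma revealment_le_maxRevealment (A : RandAlg n) (k : Fin n) :
    revealment A p k ≤ maxRevealment A p :=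
  le_ciSup (Set.finite_range _).bddAbove k

lemma maxRevealment_nonneg (A : RandAlg n) : 0 ≤ maxRevealment A p :=
  Real.iSup_nonneg fun _ => tsum_nonneg fun _ => by positivity

/-- The Schramm–Steif bound on the level-`k` weight. -/
lemma level_weight_le (hp : p ∈ Set.Ioo (0 : ℝ) 1) {k : ℕ} (hk : k ≠ 0)
    (f : (Fin n → Bool) → Bool) (A : RandAlg n) (hdet : Determines A f) :
    ∑ S with #S = k, coef p (fI f) S ^ 2 ≤
      expect p (fun ω => fI f ω ^ 2) * (k * maxRevealment A p) := by
  set W := ∑ S with #S = k, coef p (fI f) S ^ 2 with hW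
  set c := expect p (fun ω => fI f ω ^ 2) with hc
  have hc0 : 0 ≤ c := by
    rw [hc, parseval hp]
    exact sum_nonneg fun _ _ => sq_nonneg _
  have hW0 : 0 ≤ W := sum_nonneg fun _ _ => sq_nonneg _
  have hT : ∀ T : DTree n, (A T).toReal * W ^ 2 ≤ c * ∑ S with #S = k, coef p (fI f) S ^ 2 *
      ∑ i ∈ S, (A T).toReal * (bitsLaw n p {ω | i ∈ T.queries ω}).toReal := by
    intro T
    by_cases hTA : A T = 0
    · simp [hTA]
    · have hTf := hdet T ((PMF.mem_support_iff _ _).2 hTA)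
      have := mul_le_mul_of_nonneg_left (sq_level_weight_le hp hk T (fI f) fun ω ω' => by
        simp only [fI, ← hTf, (eval_queries_splice T ω ω').1])
        (ENNReal.toReal_nonneg (a := A T))
      refine this.trans (le_of_eq ?_)
      simp only [bitsLaw_toReal hp, mul_sum]
      exact sum_congr rfl fun _ _ => sum_congr rfl fun _ _ => by ring
  have hsS : ∀ S : Finset (Fin n), Summable fun T : DTree n => coef p (fI f) S ^ 2 *
      ∑ i ∈ S, (A T).toReal * (bitsLaw n p {ω | i ∈ T.queries ω}).toReal := fun S =>
    (summable_sum fun i _ => summable_revealment hp A i).mul_left _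
  have hsq := Summable.tsum_le_tsum hT ((summable_toReal_pmf A).mul_right _)
    ((summable_sum fun S _ => hsS S).mul_left _)
  rw [tsum_mul_right, tsum_toReal_pmf, one_mul, tsum_mul_left,
    Summable.tsum_finsetSum fun S _ => hsS S] at hsq
  simp only [tsum_mul_left] at hsq
  have hle : W ^ 2 ≤ c * (k * maxRevealment A p) * W := by
    refine hsq.trans ?_
    rw [mul_assoc c]
    refine mul_le_mul_of_nonneg_left ?_ hc0
    rw [hW, mul_sum]
    refine sum_le_sum fun S hS => ?_
    rw [mul_comm]
    refine mul_le_mul_of_nonneg_right ?_ (sq_nonneg _)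
    rw [Summable.tsum_finsetSum fun i _ => summable_revealment hp A i]
    refine (sum_le_sum fun i _ => revealment_le_maxRevealment (p := p) A i).trans ?_
    simp [(mem_filter.1 hS).2]
  rcases hW0.eq_or_lt with h0 | h0
  · rw [← h0]
    exact mul_nonneg hc0 (mul_nonneg k.cast_nonneg (maxRevealment_nonneg A))
  · rw [sq] at hle
    exact le_of_mul_le_mul_right hle h0

end Revealment

end BiasedCube

open BiasedCube

/-- **Proposition 2.1 (Schramm–Steif revealment bound).** If the randomized algorithm `A`
determines `f`, then the noise correlation of `f` at level `p` and noise `ε` is at most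
`e^{-εm} + m² δ_p(A,[n])` for every `m ≥ 1`. -/
theorem schramm_steif_revealment_bound
    {n : ℕ} (hn : 0 < n) (f : (Fin n → Bool) → Bool)
    (A : RandAlg n) (hdet : Determines A f)
    (p : ℝ) (hp : p ∈ Set.Ioo (0:ℝ) 1) (ε : ℝ) (hε : ε ∈ Set.Icc (0:ℝ) 1)
    (m : ℕ) (hm : 1 ≤ m) :
    pertExpB n p ε (fun ω ω' => fI f ω * fI f ω') - (∫ ω, fI f ω ∂(bitsLaw n p)) ^ 2
      ≤ Real.exp (-(ε * m)) + (m : ℝ) ^ 2 * maxRevealment A p := by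
  have hc : expect p (fun ω => fI f ω ^ 2) ≤ 1 := by
    refine (expect_mono hp fun ω => ?_).trans (expect_const (n := n) 1).le
    simp only [fI]
    split_ifs <;> norm_num
  have hδ := maxRevealment_nonneg (p := p) A
  have hmean : expect p (fI f) = coef p (fI f) ∅ := by simp [coef, chi_empty]
  rw [pertExpB_mul hp hε, integral_bitsLaw hp, hmean]
  have hsplit := Finset.add_sum_erase Finset.univ
    (fun S : Finset (Fin n) => (1 - ε) ^ S.card * coef p (fI f) S ^ 2) (Finset.mem_univ ∅)
  simp only [Finset.card_empty, pow_zero, one_mul] at hsplit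
  rw [← hsplit, add_sub_cancel_left]
  have hε0 : 0 ≤ 1 - ε := by linarith [hε.2]
  have hε1 : 1 - ε ≤ 1 := by linarith [hε.1]
  have hexp : (1 - ε) ^ m ≤ Real.exp (-(ε * m)) := by
    rw [← neg_mul, mul_comm, Real.exp_nat_mul]
    exact pow_le_pow_left₀ hε0 (Real.one_sub_le_exp_neg ε) m
  have hterm : ∀ S : Finset (Fin n), (1 - ε) ^ S.card * coef p (fI f) S ^ 2 ≤
      Real.exp (-(ε * m)) * coef p (fI f) S ^ 2 +
        if S.card < m then coef p (fI f) S ^ 2 else 0 := by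
    intro S
    have hS := sq_nonneg (coef p (fI f) S)
    split_ifs with h
    · exact (mul_le_of_le_one_left hS (pow_le_one₀ hε0 hε1)).trans
        (le_add_of_nonneg_left (by positivity))
    · rw [add_zero]
      exact mul_le_mul_of_nonneg_right
        ((pow_le_pow_of_le_one hε0 hε1 (not_lt.1 h)).trans hexp) hS
  have hhigh : ∑ S ∈ Finset.univ.erase ∅, Real.exp (-(ε * m)) * coef p (fI f) S ^ 2 ≤
      Real.exp (-(ε * m)) := by
    rw [← Finset.mul_sum]
    refine mul_le_of_le_one_right (Real.exp_pos _).le (le_trans ?_ hc)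
    rw [parseval hp]
    exact Finset.sum_le_sum_of_subset_of_nonneg (Finset.subset_univ _) fun _ _ _ => sq_nonneg _
  have hlow : ∑ S ∈ Finset.univ.erase ∅, (if S.card < m then coef p (fI f) S ^ 2 else 0) ≤
      (m : ℝ) ^ 2 * maxRevealment A p := by
    rw [← Finset.sum_filter, ← Finset.sum_fiberwise_of_maps_to (t := Finset.range m)
      (g := Finset.card) fun S hS => Finset.mem_range.2 (Finset.mem_filter.1 hS).2]
    refine (Finset.sum_le_card_nsmul _ _ (m * maxRevealment A p) fun k hk => ?_).trans ?_
    · rcases Nat.eq_zero_or_pos k with rfl | hk0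
      · rw [Finset.sum_eq_zero]
        · positivity
        · intro S hS
          simp only [Finset.mem_filter, Finset.mem_erase, Finset.card_eq_zero] at hS
          exact absurd hS.2 hS.1.1.1
      · have hkm : (k : ℝ) ≤ m := by exact_mod_cast (Finset.mem_range.1 hk).le
        calc _ ≤ ∑ S with S.card = k, coef p (fI f) S ^ 2 :=
              Finset.sum_le_sum_of_subset_of_nonneg
                (Finset.filter_subset_filter _ (Finset.subset_univ _)) fun _ _ _ => sq_nonneg _
          _ ≤ _ := level_weight_le hp hk0.ne' f A hdet
          _ ≤ 1 * (k * maxRevealment A p) := mul_le_mul_of_nonneg_right hc (by positivity)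
          _ ≤ m * maxRevealment A p := by
              rw [one_mul]
              exact mul_le_mul_of_nonneg_right hkm hδ
    · rw [Finset.card_range, nsmul_eq_mul, sq, mul_assoc]
  calc _ ≤ _ := Finset.sum_le_sum fun S _ => hterm S
    _ = _ := Finset.sum_add_distrib
    _ ≤ _ := add_le_add hhigh hlow
end
end

section
/- (OSSS inequality, Proposition 2.2.) Let f : {0,1}ⁿ → {0,1} and let A be a randomized algorithm that determines f. Then for every p ∈ (0,1): Var_p(f) ≤ p(1−p) · ∑_{k=1}^n δ_p(A, k) · Inf_k^p(f), where Var_p(f) = E_p[f²] − (E_p[f])². -/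
open MeasureTheory Set

noncomputable section

/-- The influence `Inf_k^p(f)` of bit `k` for `f` at level `p`. -/
def influence {n : ℕ} (p : ℝ) (f : (Fin n → Bool) → Bool) (k : Fin n) : ℝ :=
  ((bitsLaw n p) {ω | f ω ≠ f (Function.update ω k (!ω k))}).toReal

/-- The weight of a single bit under the Bernoulli(`p`) law. -/
def bitWeight (p : ℝ) (b : Bool) : ℝ := if b then p else 1 - p

/-- The weight of a configuration under the product Bernoulli(`p`) law. -/
def bitsWeight {n : ℕ} (p : ℝ) (x : Fin n → Bool) : ℝ := ∏ i, bitWeight p (x i)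

/-- Expectation under the product Bernoulli(`p`) law, as a finite sum. -/
def bitsExp {n : ℕ} (p : ℝ) (φ : (Fin n → Bool) → ℝ) : ℝ := ∑ x, bitsWeight p x * φ x

section BitsExp

variable {n : ℕ} {p : ℝ}

lemma bitWeight_nonneg (hp : p ∈ Set.Ioo (0 : ℝ) 1) (b : Bool) : 0 ≤ bitWeight p b := by
  cases b <;> simp [bitWeight, hp.1.le, hp.2.le]

lemma bitsWeight_nonneg (hp : p ∈ Set.Ioo (0 : ℝ) 1) (x : Fin n → Bool) : 0 ≤ bitsWeight p x :=
  Finset.prod_nonneg fun _ _ => bitWeight_nonneg hp _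

lemma sum_bitWeight_mul (g : Bool → ℝ) :
    ∑ b, bitWeight p b * g b = p * g true + (1 - p) * g false := by
  simp [bitWeight]

lemma bitsExp_add (φ ψ : (Fin n → Bool) → ℝ) :
    bitsExp p (fun x => φ x + ψ x) = bitsExp p φ + bitsExp p ψ := by
  simp [bitsExp, mul_add, Finset.sum_add_distrib]

lemma bitsExp_sub (φ ψ : (Fin n → Bool) → ℝ) :
    bitsExp p (fun x => φ x - ψ x) = bitsExp p φ - bitsExp p ψ := by
  simp [bitsExp, mul_sub, Finset.sum_sub_distrib]

lemma bitsExp_const_mul (c : ℝ) (φ : (Fin n → Bool) → ℝ) :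
    bitsExp p (fun x => c * φ x) = c * bitsExp p φ := by
  simp only [bitsExp, Finset.mul_sum]
  exact Finset.sum_congr rfl fun x _ => by ring

lemma bitsExp_mono (hp : p ∈ Set.Ioo (0 : ℝ) 1) {φ ψ : (Fin n → Bool) → ℝ}
    (h : ∀ x, φ x ≤ ψ x) : bitsExp p φ ≤ bitsExp p ψ :=
  Finset.sum_le_sum fun x _ => mul_le_mul_of_nonneg_left (h x) (bitsWeight_nonneg hp x)

lemma bitsExp_one : bitsExp p (fun _ : Fin n → Bool => 1) = 1 := by
  have h : ∀ _ : Fin n, ∑ b, bitWeight p b = 1 := fun _ => by simp [bitWeight]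
  simp only [bitsExp, bitsWeight, mul_one]
  rw [← Fintype.prod_sum fun (_ : Fin n) b => bitWeight p b]
  exact Finset.prod_eq_one fun i _ => h i

lemma bitsExp_const (c : ℝ) : bitsExp p (fun _ : Fin n → Bool => c) = c := by
  simpa [bitsExp_one] using bitsExp_const_mul (n := n) (p := p) c fun _ => 1

lemma bitsWeight_mul_bitWeight (x : Fin n → Bool) (i : Fin n) (b : Bool) :
    bitsWeight p x * bitWeight p b
      = bitsWeight p (Function.update x i b) * bitWeight p (x i) := by
  simp only [bitsWeight]
  rw [← Finset.mul_prod_erase _ _ (Finset.mem_univ i),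
    ← Finset.mul_prod_erase (a := i) _ (fun j => bitWeight p (Function.update x i b j))
      (Finset.mem_univ i), Function.update_self]
  have : ∏ j ∈ Finset.univ.erase i, bitWeight p (Function.update x i b j)
      = ∏ j ∈ Finset.univ.erase i, bitWeight p (x j) :=
    Finset.prod_congr rfl fun j hj => by
      rw [Function.update_of_ne (Finset.ne_of_mem_erase hj)]
  rw [this]
  ring

/-- Resampling one coordinate does not change expectations. -/
lemma bitsExp_resample (i : Fin n) (φ : (Fin n → Bool) → ℝ) :
    bitsExp p φ = ∑ b, bitWeight p b * bitsExp p fun x => φ (Function.update x i b) := by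
  let e : (Fin n → Bool) × Bool → (Fin n → Bool) × Bool :=
    fun z => (Function.update z.1 i z.2, z.1 i)
  have he : Function.Involutive e := fun z => by simp [e]
  have hs : ∑ b, bitWeight p b = 1 := by simp [bitWeight]
  calc bitsExp p φ
      = ∑ z : (Fin n → Bool) × Bool, bitsWeight p z.1 * bitWeight p z.2 * φ z.1 := by
        rw [Fintype.sum_prod_type]
        refine Finset.sum_congr rfl fun x _ => ?_
        dsimp only
        rw [← Finset.sum_mul, ← Finset.mul_sum, hs, mul_one]
    _ = ∑ z : (Fin n → Bool) × Bool,
          bitsWeight p z.1 * bitWeight p z.2 * φ (Function.update z.1 i z.2) := by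
        refine Fintype.sum_equiv he.toPerm _ _ fun z => ?_
        simp only [Function.Involutive.coe_toPerm, e, Function.update_idem,
          Function.update_eq_self]
        rw [bitsWeight_mul_bitWeight z.1 i z.2]
    _ = _ := by
        rw [Fintype.sum_prod_type, Finset.sum_comm]
        refine Finset.sum_congr rfl fun b _ => ?_
        rw [bitsExp, Finset.mul_sum]
        exact Finset.sum_congr rfl fun x _ => by ring

lemma integral_bitsLaw (hp : p ∈ Set.Ioo (0 : ℝ) 1) (φ : (Fin n → Bool) → ℝ) :
    ∫ x, φ x ∂(bitsLaw n p) = bitsExp p φ := by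
  have : IsFiniteMeasure (berMeasure p) := by unfold berMeasure; infer_instance
  have : IsFiniteMeasure (bitsLaw n p) := by unfold bitsLaw; infer_instance
  rw [integral_fintype (Integrable.of_finite)]
  refine Finset.sum_congr rfl fun x _ => ?_
  rw [smul_eq_mul, Measure.real, bitsLaw, Measure.pi_singleton, ENNReal.toReal_prod]
  congr 1
  refine Finset.prod_congr rfl fun i _ => ?_
  cases x i <;> simp [berMeasure, bitWeight, hp.1.le, hp.2.le]

lemma toReal_bitsLaw (hp : p ∈ Set.Ioo (0 : ℝ) 1) (s : (Fin n → Bool) → Prop)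
    [DecidablePred s] :
    ((bitsLaw n p) {x | s x}).toReal = bitsExp p fun x => if s x then 1 else 0 := by
  rw [← integral_bitsLaw hp]
  have := integral_indicator_one (μ := bitsLaw n p) (s := {x | s x})
    (Set.toFinite _).measurableSet
  rw [Measure.real] at this
  rw [← this]
  refine integral_congr_ae (Filter.Eventually.of_forall fun x => ?_)
  simp [Set.indicator_apply]

end BitsExp

section Reveal

variable {n : ℕ} {p : ℝ}

/-- The configuration equal to `x` on `s` and to `y` off `s`. -/
def overwrite (s : Finset (Fin n)) (x y : Fin n → Bool) : Fin n → Bool := s.piecewise x y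

/-- The mean change of `φ` when coordinate `k` is resampled. -/
def resampleInfluence (p : ℝ) (φ : (Fin n → Bool) → ℝ) (k : Fin n) : ℝ :=
  ∑ b, bitWeight p b * bitsExp p fun z => |φ (Function.update z k b) - φ z|

/-- Probability that the random set `Q` contains `k`. -/
def revealProb (p : ℝ) (Q : (Fin n → Bool) → Finset (Fin n)) (k : Fin n) : ℝ :=
  bitsExp p fun x => if k ∈ Q x then 1 else 0

/-- Replacing the coordinates in `Q x` of an independent sample by those of `x` preserves the law
of the sample, and changes functions by at most the revealed resampling influences. -/
structure RevealBound (p : ℝ) (Q : (Fin n → Bool) → Finset (Fin n)) : Prop where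
  law : ∀ φ : (Fin n → Bool) → ℝ,
    (bitsExp p fun x => bitsExp p fun y => φ (overwrite (Q x) x y)) = bitsExp p φ
  le : ∀ φ : (Fin n → Bool) → ℝ,
    (bitsExp p fun x => bitsExp p fun y => |φ (overwrite (Q x) x y) - φ y|)
      ≤ ∑ k, revealProb p Q k * resampleInfluence p φ k

lemma RevealBound.empty : RevealBound (n := n) p fun _ => ∅ where
  law φ := by simp [overwrite, bitsExp_const]
  le φ := by simp [overwrite, bitsExp_const, revealProb]

lemma overwrite_of_mem {s : Finset (Fin n)} {i : Fin n} (hi : i ∈ s) (x y : Fin n → Bool) :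
    overwrite s x y i = x i := by
  simp [overwrite, hi]

lemma overwrite_of_notMem {s : Finset (Fin n)} {i : Fin n} (hi : i ∉ s) (x y : Fin n → Bool) :
    overwrite s x y i = y i := by
  simp [overwrite, hi]

lemma overwrite_empty (x y : Fin n → Bool) : overwrite ∅ x y = y := by
  simp [overwrite]

lemma overwrite_update_of_notMem {s : Finset (Fin n)} {i : Fin n} (hi : i ∉ s)
    (x y : Fin n → Bool) (b : Bool) :
    overwrite s (Function.update x i b) y = overwrite s x y := by
  ext j
  unfold overwrite
  by_cases hj : j ∈ s
  · simp [hj, Function.update_of_ne (ne_of_mem_of_not_mem hj hi)]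
  · simp [hj]

/-- Reading a fresh coordinate `i` first, and then revealing a set depending on its value. -/
lemma RevealBound.insert (hp : p ∈ Set.Ioo (0 : ℝ) 1) (i : Fin n)
    {Q : Bool → (Fin n → Bool) → Finset (Fin n)}
    (hinv : ∀ b c x, Q b (Function.update x i c) = Q b x) (hi : ∀ b x, i ∉ Q b x)
    (hQ : ∀ b, RevealBound p (Q b)) :
    RevealBound p fun x => insert i (Q (x i) x) := by
  have hpw : ∀ b x y, overwrite (Insert.insert i (Q b x)) (Function.update x i b) y
      = Function.update (overwrite (Q b x) x y) i b := fun b x y => by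
    rw [overwrite, Finset.piecewise_insert, ← overwrite, overwrite_update_of_notMem (hi b x),
      Function.update_self]
  refine ⟨fun φ => ?_, fun φ => ?_⟩
  · rw [bitsExp_resample i]
    simp only [Function.update_self, hinv, hpw]
    rw [bitsExp_resample i φ]
    exact Finset.sum_congr rfl fun b _ => by
      rw [(hQ b).law fun z => φ (Function.update z i b)]
  · have hprob : ∀ k, revealProb p (fun x => Insert.insert i (Q (x i) x)) k
        = (if k = i then 1 else 0) + ∑ b, bitWeight p b * revealProb p (Q b) k := by
      intro k
      rw [revealProb, bitsExp_resample i]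
      simp only [Function.update_self, hinv]
      by_cases hk : k = i
      · subst hk
        simp [revealProb, hi, bitsExp_const, bitWeight]
      · simp [hk, revealProb]
    rw [bitsExp_resample i]
    simp only [Function.update_self, hinv, hpw]
    calc ∑ b, bitWeight p b * (bitsExp p fun x => bitsExp p fun y =>
            |φ (Function.update (overwrite (Q b x) x y) i b) - φ y|)
        ≤ ∑ b, bitWeight p b * ((bitsExp p fun z => |φ (Function.update z i b) - φ z|)
            + ∑ k, revealProb p (Q b) k * resampleInfluence p φ k) := by
          refine Finset.sum_le_sum fun b _ =>
            mul_le_mul_of_nonneg_left ?_ (bitWeight_nonneg hp b)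
          rw [← (hQ b).law fun z => |φ (Function.update z i b) - φ z|]
          refine le_trans ?_ (add_le_add_right ((hQ b).le φ) _)
          simp only [← bitsExp_add]
          exact bitsExp_mono hp fun x => bitsExp_mono hp fun y => abs_sub_le _ _ _
      _ = _ := by
          simp only [hprob, mul_add, add_mul, Finset.sum_add_distrib, ite_mul, one_mul, zero_mul,
            Finset.sum_ite_eq', Finset.mem_univ, if_true, Finset.mul_sum, Finset.sum_mul]
          rw [Finset.sum_comm]
          simp only [resampleInfluence, mul_assoc]

lemma DTree.revealBound (hp : p ∈ Set.Ioo (0 : ℝ) 1) (T : DTree n) (S : Finset (Fin n))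
    (a : Fin n → Bool) : RevealBound p fun x => T.queries (overwrite S a x) \ S := by
  induction T generalizing S a with
  | leaf b => simpa [DTree.queries] using RevealBound.empty
  | node i t₁ t₀ ih₁ ih₀ =>
    by_cases hiS : i ∈ S
    · cases hai : a i
      · simpa [DTree.queries, hiS, overwrite_of_mem, hai, Finset.insert_sdiff_of_mem] using ih₀ S a
      · simpa [DTree.queries, hiS, overwrite_of_mem, hai, Finset.insert_sdiff_of_mem] using ih₁ S a
    · let Q : Bool → (Fin n → Bool) → Finset (Fin n) := fun b x =>
        (if b then t₁ else t₀).queries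
          (overwrite (Insert.insert i S) (Function.update a i b) x) \ Insert.insert i S
      have key : RevealBound p fun x => Insert.insert i (Q (x i) x) := by
        refine RevealBound.insert hp i (fun b c x => ?_) (fun b x => ?_) fun b => ?_
        · have : overwrite (Insert.insert i S) (Function.update a i b) (Function.update x i c)
              = overwrite (Insert.insert i S) (Function.update a i b) x := by
            ext j
            by_cases hj : j = i
            · subst hj; simp [overwrite]
            · simp [overwrite, Finset.piecewise, hj]
          simp only [Q, this]
        · simp [Q]
        · cases b
          · exact ih₀ _ _
          · exact ih₁ _ _
      convert key using 2 with x
      have hx : overwrite (Insert.insert i S) (Function.update a i (x i)) x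
          = overwrite S a x := by
        rw [overwrite, Finset.piecewise_insert, ← overwrite, overwrite_update_of_notMem hiS,
          Function.update_self]
        exact Function.update_eq_self_iff.2 (overwrite_of_notMem hiS a x).symm
      simp only [Q, hx]
      ext j
      cases hxi : x i <;> by_cases hj : j = i <;>
        simp [DTree.queries, hiS, overwrite_of_notMem, hxi, hj]

lemma DTree.eval_congr (T : DTree n) {x y : Fin n → Bool}
    (h : ∀ k ∈ T.queries x, x k = y k) : T.eval x = T.eval y := by
  induction T with
  | leaf b => rfl
  | node i t₁ t₀ ih₁ ih₀ =>
    simp only [DTree.queries, Finset.mem_insert, forall_eq_or_imp] at h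
    simp only [DTree.eval, ← h.1]
    cases hx : x i
    · simpa using ih₀ (by simpa [hx] using h.2)
    · simpa using ih₁ (by simpa [hx] using h.2)

lemma resampleInfluence_fI (hp : p ∈ Set.Ioo (0 : ℝ) 1) (f : (Fin n → Bool) → Bool)
    (k : Fin n) : resampleInfluence p (fI f) k = 2 * (p * (1 - p)) * influence p f k := by
  have hinf : influence p f k = bitsExp p fun z =>
      |fI f (Function.update z k true) - fI f (Function.update z k false)| := by
    rw [influence, toReal_bitsLaw hp, bitsExp_resample k]
    have h : ∀ b z, (if f (Function.update z k b) ≠ f (Function.update (Function.update z k b) k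
        (!(Function.update z k b k))) then (1 : ℝ) else 0)
        = |fI f (Function.update z k true) - fI f (Function.update z k false)| := by
      intro b z
      cases b <;> cases h₁ : f (Function.update z k true) <;>
        cases h₀ : f (Function.update z k false) <;> simp [fI, h₁, h₀]
    simp only [h, sum_bitWeight_mul]
    ring
  have h : ∀ b, (bitsExp p fun z => |fI f (Function.update z k b) - fI f z|)
      = bitWeight p (!b) * influence p f k := by
    intro b
    rw [bitsExp_resample k, hinf]
    cases b <;> simp [bitWeight, bitsExp_const, abs_sub_comm]
  simp only [resampleInfluence, h, sum_bitWeight_mul]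
  simp only [bitWeight, Bool.not_true, Bool.not_false, if_true, Bool.false_eq_true, if_false]
  ring

lemma two_mul_variance_fI (f : (Fin n → Bool) → Bool) :
    2 * ((bitsExp p fun x => fI f x ^ 2) - bitsExp p (fI f) ^ 2)
      = bitsExp p fun x => bitsExp p fun y => |fI f x - fI f y| := by
  have h : ∀ x y, |fI f x - fI f y| = fI f x ^ 2 + fI f y ^ 2 - 2 * fI f x * fI f y := by
    intro x y
    cases hx : f x <;> cases hy : f y <;> norm_num [fI, hx, hy]
  simp only [h, bitsExp_sub, bitsExp_add, bitsExp_const_mul, bitsExp_const]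
  have : (bitsExp p fun x => 2 * fI f x * bitsExp p fun y => fI f y)
      = 2 * bitsExp p (fI f) * bitsExp p (fI f) := by
    rw [mul_right_comm, ← bitsExp_const_mul]
    exact congrArg _ (funext fun x => by ring)
  rw [this]
  ring

/-- The OSSS inequality for a single decision tree. -/
lemma DTree.variance_le (hp : p ∈ Set.Ioo (0 : ℝ) 1) (T : DTree n)
    (f : (Fin n → Bool) → Bool) (hT : ∀ x, T.eval x = f x) :
    (bitsExp p fun x => fI f x ^ 2) - bitsExp p (fI f) ^ 2
      ≤ p * (1 - p) * ∑ k, revealProb p T.queries k * influence p f k := by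
  have h := (T.revealBound hp ∅ fun _ => true).le (fI f)
  have hf : ∀ x y, fI f (overwrite (T.queries x) x y) = fI f x := by
    intro x y
    simp only [fI, ← hT]
    rw [T.eval_congr (x := x) (y := overwrite (T.queries x) x y) fun k hk =>
      (overwrite_of_mem hk x y).symm]
  simp only [overwrite_empty, Finset.sdiff_empty, hf, ← two_mul_variance_fI,
    resampleInfluence_fI hp] at h
  have : ∑ k, revealProb p T.queries k * (2 * (p * (1 - p)) * influence p f k)
      = 2 * (p * (1 - p) * ∑ k, revealProb p T.queries k * influence p f k) := by
    simp only [Finset.mul_sum]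
    exact Finset.sum_congr rfl fun k _ => by ring
  linarith

end Reveal

/-- **Proposition 2.2 (OSSS inequality).** If the randomized algorithm `A` determines `f`, then
`Var_p(f) ≤ p(1-p) ∑_k δ_p(A,k) Inf_k^p(f)`. -/
theorem osss_inequality
    {n : ℕ} (f : (Fin n → Bool) → Bool)
    (A : RandAlg n) (hdet : Determines A f)
    (p : ℝ) (hp : p ∈ Set.Ioo (0:ℝ) 1) :
    (∫ ω, (fI f ω) ^ 2 ∂(bitsLaw n p)) - (∫ ω, fI f ω ∂(bitsLaw n p)) ^ 2
      ≤ p * (1 - p) * ∑ k : Fin n, revealment A p k * influence p f k := by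
  simp only [integral_bitsLaw hp]
  have hA : HasSum (fun T => (A T).toReal) 1 := by
    have := ENNReal.hasSum_toReal (f := fun T => A T) (by simp [A.tsum_coe])
    simpa [← ENNReal.tsum_toReal_eq A.apply_ne_top, A.tsum_coe] using this
  have hrev : ∀ k, HasSum (fun T : DTree n => (A T).toReal * revealProb p T.queries k)
      (revealment A p k) := by
    intro k
    simp only [revealment, toReal_bitsLaw hp]
    refine Summable.hasSum (hA.summable.of_nonneg_of_le (fun T => ?_) fun T => ?_)
    · refine mul_nonneg ENNReal.toReal_nonneg ?_
      rw [← bitsExp_const (n := n) (p := p) 0]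
      exact bitsExp_mono hp fun x => by split_ifs <;> norm_num
    · refine mul_le_of_le_one_right ENNReal.toReal_nonneg ?_
      rw [← bitsExp_one (n := n) (p := p)]
      exact bitsExp_mono hp fun x => by split_ifs <;> norm_num
  have hsum := (hasSum_sum (s := Finset.univ) fun k _ =>
    (hrev k).mul_right (influence p f k)).mul_left (p * (1 - p))
  rw [← one_mul (_ - _)]
  refine hasSum_le (fun T => ?_) (hA.mul_right _) hsum
  by_cases hT : T ∈ A.support
  · refine (mul_le_mul_of_nonneg_left (T.variance_le hp f (hdet T hT))
      ENNReal.toReal_nonneg).trans_eq ?_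
    simp only [Finset.mul_sum]
    exact Finset.sum_congr rfl fun k _ => by ring
  · simp [(A.apply_eq_zero_iff T).2 hT]
end
end
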